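/- arXiv:math/0612768 — 11 statements merged into one kernel-verified Lean document; each statement's English description precedes it below -/
import Mathlib

section
/- Let λ, μ ∈ X⁺ be dominant weights. If it is not the case that λ < μ (in the dominance order), then U(λ,μ) = ∅ and V(λ,μ) = ∅. If λ < μ, then the defining inequalities on n and m are automatic: U(λ,μ) = {(γ,w,n) : γ ∈ R⁺, w ∈ W, n ∈ ℤ, λ − nγ = w·μ} and V(λ,μ) = {(β,x,m) : β ∈ R⁺, x ∈ W, m ∈ ℤ, μ − mβ = x·λ}. -/
open scoped InnerProductSpace Classical

noncomputable section

variable {E : Type*} [NormedAddCommGroup E] [InnerProductSpace ℝ E]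

/-- `⟨x, α∨⟩ = 2⟪x,α⟫/⟪α,α⟫`. -/
def coPair (x α : E) : ℝ := 2 * ⟪x, α⟫_ℝ / ⟪α, α⟫_ℝ

/-- The orthogonal reflection `s_α(x) = x − ⟨x,α∨⟩α`, as a plain function. -/
def sRefl (α x : E) : E := x - coPair x α • α

/-- `R` is a finite crystallographic root system in `E`. -/
structure IsRootSystem (R : Finset E) : Prop where
  span_eq_top : Submodule.span ℝ (R : Set E) = ⊤
  zero_not_mem : (0 : E) ∉ R
  refl_stable : ∀ α ∈ R, ∀ β ∈ R, sRefl α β ∈ R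
  crystallographic : ∀ α ∈ R, ∀ β ∈ R, ∃ n : ℤ, coPair β α = (n : ℝ)

/-- The positive roots with respect to a regular vector `v`. -/
def posR (R : Finset E) (v : E) : Finset E := R.filter fun α => 0 < ⟪v, α⟫_ℝ

/-- `ρ`, the half sum of the positive roots. -/
def rhoR (R : Finset E) (v : E) : E := (2 : ℝ)⁻¹ • ∑ α ∈ posR R v, α

/-- The Weyl group: the group of linear isometries of `E` generated by the
reflections `s_α`, `α ∈ R`. -/
def Weyl (R : Finset E) : Subgroup (E ≃ₗᵢ[ℝ] E) :=
  Subgroup.closure {g | ∃ α ∈ R, ∀ x, g x = sRefl α x}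

/-- The dot action `w·λ = w(λ+ρ) − ρ`. -/
def dotAct (R : Finset E) (v : E) (w : E ≃ₗᵢ[ℝ] E) (lam : E) : E :=
  w (lam + rhoR R v) - rhoR R v

/-- membership in the weight lattice `X`. -/
def IsWeight (R : Finset E) (lam : E) : Prop := ∀ α ∈ R, ∃ n : ℤ, coPair lam α = (n : ℝ)

/-- membership in `X⁺`, the set of dominant weights. -/
def IsDominant (R : Finset E) (v : E) (lam : E) : Prop :=
  IsWeight R lam ∧ ∀ α ∈ posR R v, 0 ≤ coPair lam α

/-- the strict dominance order `λ < μ`:  `μ − λ` is a nonzero `ℕ`-linear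
combination of positive roots. -/
def domLt (R : Finset E) (v : E) (lam mu : E) : Prop :=
  lam ≠ mu ∧ ∃ c : E → ℕ, mu - lam = ∑ α ∈ posR R v, (c α : ℝ) • α

/-- `V_β(λ,μ)`. -/
def VsetB (R : Finset E) (v lam mu β : E) : Set ((E ≃ₗᵢ[ℝ] E) × ℤ) :=
  {p | p.1 ∈ Weyl R ∧ 0 < p.2 ∧ (p.2 : ℝ) < coPair (mu + rhoR R v) β ∧
    dotAct R v p.1 lam = mu - (p.2 : ℝ) • β}

/-- `U_γ(λ,μ)`. -/
def UsetG (R : Finset E) (v lam mu γ : E) : Set ((E ≃ₗᵢ[ℝ] E) × ℤ) :=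
  {p | p.1 ∈ Weyl R ∧ (p.2 < 0 ∨ coPair (lam + rhoR R v) γ < (p.2 : ℝ)) ∧
    dotAct R v p.1 mu = lam - (p.2 : ℝ) • γ}

/-- `V(λ,μ)`. -/
def Vset (R : Finset E) (v lam mu : E) : Set (E × (E ≃ₗᵢ[ℝ] E) × ℤ) :=
  {t | t.1 ∈ posR R v ∧ (t.2.1, t.2.2) ∈ VsetB R v lam mu t.1}

/-- `U(λ,μ)`. -/
def Uset (R : Finset E) (v lam mu : E) : Set (E × (E ≃ₗᵢ[ℝ] E) × ℤ) :=
  {t | t.1 ∈ posR R v ∧ (t.2.1, t.2.2) ∈ UsetG R v lam mu t.1}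

lemma coPair_add (x y α : E) : coPair (x + y) α = coPair x α + coPair y α := by
  simp only [coPair, inner_add_left]; ring

lemma coPair_smul (c : ℝ) (x α : E) : coPair (c • x) α = c * coPair x α := by
  simp only [coPair, real_inner_smul_left]; ring

lemma coPair_sub (x y α : E) : coPair (x - y) α = coPair x α - coPair y α := by
  simp only [coPair, inner_sub_left]; ring

lemma coPair_self {α : E} (hα : α ≠ 0) : coPair α α = 2 := by
  have : ⟪α, α⟫_ℝ ≠ 0 := inner_self_ne_zero.mpr hα
  simp only [coPair]; field_simp

lemma coPair_sum {ι : Type*} (s : Finset ι) (f : ι → E) (α : E) :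
    coPair (∑ i ∈ s, f i) α = ∑ i ∈ s, coPair (f i) α := by
  simp only [coPair, sum_inner, Finset.mul_sum, Finset.sum_div]

lemma coPair_map (g : E ≃ₗᵢ[ℝ] E) (x α : E) : coPair (g x) (g α) = coPair x α := by
  simp only [coPair, LinearIsometryEquiv.inner_map_map]

lemma coPair_mul_inner_self {α : E} (hα : α ≠ 0) (x : E) :
    coPair x α * ⟪α, α⟫_ℝ = 2 * ⟪x, α⟫_ℝ := by
  have : ⟪α, α⟫_ℝ ≠ 0 := inner_self_ne_zero.mpr hα
  simp only [coPair]; field_simp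

lemma coPair_nonneg_iff {α : E} (hα : α ≠ 0) (x : E) : 0 ≤ coPair x α ↔ 0 ≤ ⟪x, α⟫_ℝ := by
  have h : 0 < ⟪α, α⟫_ℝ := real_inner_self_pos.mpr hα
  rw [← mul_nonneg_iff_of_pos_right h, coPair_mul_inner_self hα]
  constructor <;> intro <;> linarith

lemma coPair_pos {α x : E} (hα : α ≠ 0) (h : 0 < ⟪x, α⟫_ℝ) : 0 < coPair x α := by
  have := real_inner_self_pos.mpr hα
  unfold coPair; positivity

/-- The reflection `s_α` as a linear isometry. -/
def reflIso (α : E) : E ≃ₗᵢ[ℝ] E := (ℝ ∙ α)ᗮ.reflection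

lemma reflIso_apply (α x : E) : reflIso α x = sRefl α x := by
  rw [reflIso, Submodule.reflection_orthogonal_apply, Submodule.reflection_singleton_apply,
    sRefl, coPair, real_inner_self_eq_norm_sq, real_inner_comm]
  simp only [RCLike.ofReal_real_eq_id, id_eq, smul_smul, neg_sub, ← Nat.cast_smul_eq_nsmul ℝ]
  congr 2
  push_cast
  ring

lemma reflIso_mul_self (α : E) : reflIso α * reflIso α = 1 :=
  Submodule.reflection_mul_reflection _

lemma reflIso_inv (α : E) : (reflIso α)⁻¹ = reflIso α :=
  inv_eq_of_mul_eq_one_left (reflIso_mul_self α)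

lemma reflIso_involutive (α x : E) : reflIso α (reflIso α x) = x :=
  DFunLike.congr_fun (reflIso_mul_self α) x

lemma inv_apply_apply (w : E ≃ₗᵢ[ℝ] E) (x : E) : w⁻¹ (w x) = x := w.symm_apply_apply x

lemma apply_inv_apply (w : E ≃ₗᵢ[ℝ] E) (x : E) : w (w⁻¹ x) = x := w.apply_symm_apply x

lemma reflIso_smul {t : ℝ} (ht : t ≠ 0) (α : E) : reflIso (t • α) = reflIso α := by
  ext x
  simp only [reflIso_apply, sRefl, coPair, smul_smul, real_inner_smul_left, real_inner_smul_right]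
  congr 2
  field_simp

lemma reflIso_mul_comm (g : E ≃ₗᵢ[ℝ] E) (α : E) : reflIso (g α) * g = g * reflIso α := by
  ext x
  simp only [LinearIsometryEquiv.coe_mul, Function.comp_apply, reflIso_apply, sRefl, coPair_map,
    map_sub, map_smul]

lemma reflIso_self {α : E} (hα : α ≠ 0) : reflIso α α = -α := by
  rw [reflIso_apply, sRefl, coPair_self hα, two_smul]; abel

lemma coPair_reflIso {α : E} (hα : α ≠ 0) (x : E) : coPair (reflIso α x) α = -coPair x α := by
  rw [reflIso_apply, sRefl, coPair_sub, coPair_smul, coPair_self hα]; ring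

lemma mem_posR {R : Finset E} {v α : E} : α ∈ posR R v ↔ α ∈ R ∧ 0 < ⟪v, α⟫_ℝ := by
  simp [posR]

lemma ne_zero_of_mem_posR {R : Finset E} {v α : E} (h : α ∈ posR R v) : α ≠ 0 := by
  rintro rfl
  simpa using (mem_posR.mp h).2

/-- The simple roots: the positive roots which are not a sum of two positive roots. -/
def simpleR (R : Finset E) (v : E) : Set E :=
  {α | α ∈ posR R v ∧ ∀ β ∈ posR R v, ∀ γ ∈ posR R v, α ≠ β + γ}

/-- The monoid of `ℕ`-linear combinations of positive roots. -/
def posCone (R : Finset E) (v : E) : AddSubmonoid E := AddSubmonoid.closure (posR R v : Set E)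

lemma mem_posCone_iff {R : Finset E} {v x : E} :
    x ∈ posCone R v ↔ ∃ c : E → ℕ, x = ∑ α ∈ posR R v, (c α : ℝ) • α := by
  constructor
  · intro h
    obtain ⟨f, -, rfl⟩ := AddSubmonoid.mem_closure_finset.mp h
    exact ⟨f, by simp only [Nat.cast_smul_eq_nsmul]⟩
  · rintro ⟨c, rfl⟩
    refine sum_mem fun α hα => ?_
    rw [Nat.cast_smul_eq_nsmul]
    exact nsmul_mem (AddSubmonoid.subset_closure hα) _

lemma natCast_smul_mem_posCone {R : Finset E} {v α : E} (h : α ∈ posR R v) {c : ℝ}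
    (hc : ∃ n : ℕ, c = n) : c • α ∈ posCone R v := by
  obtain ⟨n, rfl⟩ := hc
  rw [Nat.cast_smul_eq_nsmul]
  exact nsmul_mem (AddSubmonoid.subset_closure h) _

/-- The product of the reflections in a list of vectors. -/
def wordProd (L : List E) : E ≃ₗᵢ[ℝ] E := (L.map reflIso).prod

@[simp] lemma wordProd_nil : wordProd ([] : List E) = 1 := rfl

@[simp] lemma wordProd_cons (α : E) (L : List E) : wordProd (α :: L) = reflIso α * wordProd L := by
  simp [wordProd]

@[simp] lemma wordProd_append (L M : List E) : wordProd (L ++ M) = wordProd L * wordProd M := by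
  simp [wordProd]

lemma wordProd_reverse (L : List E) : wordProd L.reverse = (wordProd L)⁻¹ := by
  induction L with
  | nil => simp
  | cons α L ih => simp [ih, reflIso_inv]

/-- A vector pairing to natural numbers with all simple coroots. -/
def IsSimplyDominant (R : Finset E) (v x : E) : Prop :=
  ∀ α ∈ simpleR R v, ∃ n : ℕ, coPair x α = n

namespace IsRootSystem

variable {R : Finset E} {v : E}

lemma ne_zero (hR : IsRootSystem R) {α : E} (h : α ∈ R) : α ≠ 0 := by
  rintro rfl; exact hR.zero_not_mem h

lemma reflIso_mem (hR : IsRootSystem R) {α β : E} (hα : α ∈ R) (hβ : β ∈ R) :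
    reflIso α β ∈ R := by
  rw [reflIso_apply]; exact hR.refl_stable α hα β hβ

lemma neg_mem (hR : IsRootSystem R) {α : E} (h : α ∈ R) : -α ∈ R := by
  rw [← reflIso_self (hR.ne_zero h)]; exact hR.reflIso_mem h h

lemma mem_posR_or_neg (hR : IsRootSystem R) (hv : ∀ α ∈ R, ⟪v, α⟫_ℝ ≠ 0) {α : E} (h : α ∈ R) :
    α ∈ posR R v ∨ -α ∈ posR R v := by
  rcases lt_or_gt_of_ne (hv α h) with h0 | h0
  · right; rw [mem_posR, inner_neg_right]; exact ⟨hR.neg_mem h, by linarith⟩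
  · left; exact mem_posR.mpr ⟨h, h0⟩

lemma reflIso_mem_weyl {α : E} (h : α ∈ R) : reflIso α ∈ Weyl R :=
  Subgroup.subset_closure ⟨α, h, reflIso_apply α⟩

lemma weyl_map_mem (hR : IsRootSystem R) {w : E ≃ₗᵢ[ℝ] E} (hw : w ∈ Weyl R) :
    ∀ α ∈ R, w α ∈ R := by
  have key : ∀ g : E ≃ₗᵢ[ℝ] E, (∃ α ∈ R, ∀ x, g x = sRefl α x) → ∃ α ∈ R, g = reflIso α := by
    rintro g ⟨α, hα, h⟩
    exact ⟨α, hα, by ext x; rw [h, reflIso_apply]⟩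
  induction hw using Subgroup.closure_induction_left with
  | one => intro α h; exact h
  | mul_left g hg w _ ih =>
    obtain ⟨β, hβ, rfl⟩ := key g hg
    intro α hα
    exact hR.reflIso_mem hβ (ih α hα)
  | inv_mul_cancel g hg w _ ih =>
    obtain ⟨β, hβ, rfl⟩ := key g hg
    intro α hα
    rw [reflIso_inv]
    exact hR.reflIso_mem hβ (ih α hα)

lemma posR_induction {P : E → Prop}
    (h : ∀ β ∈ posR R v, (∀ γ ∈ posR R v, ⟪v, γ⟫_ℝ < ⟪v, β⟫_ℝ → P γ) → P β) :
    ∀ β ∈ posR R v, P β := by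
  by_contra! hne
  obtain ⟨β, hβ, hP⟩ := hne
  obtain ⟨γ, hγ, hmin⟩ := ((posR R v).filter fun β => ¬ P β).exists_min_image (fun x => ⟪v, x⟫_ℝ)
    ⟨β, Finset.mem_filter.mpr ⟨hβ, hP⟩⟩
  rw [Finset.mem_filter] at hγ
  refine hγ.2 (h γ hγ.1 fun δ hδ hlt => ?_)
  by_contra hPδ
  exact absurd (hmin δ (Finset.mem_filter.mpr ⟨hδ, hPδ⟩)) (not_le.mpr hlt)

lemma mem_closure_simpleR : ∀ β ∈ posR R v, β ∈ AddSubmonoid.closure (simpleR R v) := by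
  refine posR_induction fun β hβ ih => ?_
  by_cases hs : β ∈ simpleR R v
  · exact AddSubmonoid.subset_closure hs
  · have : ∃ γ ∈ posR R v, ∃ δ ∈ posR R v, β = γ + δ := by
      by_contra! hne
      exact hs ⟨hβ, hne⟩
    obtain ⟨γ, hγ, δ, hδ, rfl⟩ := this
    have h1 := (mem_posR.mp hγ).2
    have h2 := (mem_posR.mp hδ).2
    refine add_mem (ih γ hγ ?_) (ih δ hδ ?_) <;> rw [inner_add_right] <;> linarith

lemma inner_simple_nonpos (hR : IsRootSystem R) (hv : ∀ α ∈ R, ⟪v, α⟫_ℝ ≠ 0) {α β : E}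
    (hα : α ∈ simpleR R v) (hβ : β ∈ simpleR R v) (hne : α ≠ β) : ⟪α, β⟫_ℝ ≤ 0 := by
  by_contra! hpos
  have hαR := (mem_posR.mp hα.1).1
  have hβR := (mem_posR.mp hβ.1).1
  have hα0 := hR.ne_zero hαR
  have hβ0 := hR.ne_zero hβR
  have hpos' : 0 < ⟪β, α⟫_ℝ := by rwa [real_inner_comm]
  have hsub : α - β ∉ R := by
    intro h
    rcases hR.mem_posR_or_neg hv h with h | h
    · exact hα.2 β hβ.1 _ h (by abel)
    · exact hβ.2 α hα.1 _ h (by abel)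
  obtain ⟨p, hp⟩ := hR.crystallographic α hαR β hβR
  obtain ⟨q, hq⟩ := hR.crystallographic β hβR α hαR
  have hp0 : 0 < p := by
    have := coPair_pos hα0 hpos'
    rw [hp] at this; exact_mod_cast this
  have hq0 : 0 < q := by
    have := coPair_pos hβ0 hpos
    rw [hq] at this; exact_mod_cast this
  have hp1 : p ≠ 1 := by
    rintro rfl
    apply hsub
    have := hR.neg_mem (hR.refl_stable α hαR β hβR)
    simpa [sRefl, hp] using this
  have hq1 : q ≠ 1 := by
    rintro rfl
    apply hsub
    have := hR.refl_stable β hβR α hαR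
    simpa [sRefl, hq] using this
  have hp2 : (2 : ℝ) ≤ p := by exact_mod_cast (by omega : 2 ≤ p)
  have hq2 : (2 : ℝ) ≤ q := by exact_mod_cast (by omega : 2 ≤ q)
  have e1 := coPair_mul_inner_self hα0 β
  have e2 := coPair_mul_inner_self hβ0 α
  rw [hp, real_inner_comm α β] at e1
  rw [hq] at e2
  have a1 : 0 < ⟪α, α⟫_ℝ := real_inner_self_pos.mpr hα0
  have b1 : 0 < ⟪β, β⟫_ℝ := real_inner_self_pos.mpr hβ0
  apply hne
  have h0 : ⟪α - β, α - β⟫_ℝ ≤ 0 := by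
    rw [real_inner_sub_sub_self]
    nlinarith
  rw [real_inner_self_eq_norm_sq] at h0
  exact sub_eq_zero.mp (norm_eq_zero.mp (pow_eq_zero_iff two_ne_zero |>.mp (h0.antisymm (sq_nonneg _))))

lemma exists_nsmul_add_of_mem_closure {S : Set E} {x : E} (α : E)
    (h : x ∈ AddSubmonoid.closure S) :
    ∃ n : ℕ, ∃ y ∈ AddSubmonoid.closure (S \ {α}), x = (n : ℝ) • α + y := by
  induction h using AddSubmonoid.closure_induction with
  | mem x hx =>
    by_cases hxα : x = α
    · exact ⟨1, 0, zero_mem _, by simp [hxα]⟩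
    · exact ⟨0, x, AddSubmonoid.subset_closure ⟨hx, hxα⟩, by simp⟩
  | zero => exact ⟨0, 0, zero_mem _, by simp⟩
  | add x y _ _ hx hy =>
    obtain ⟨n, a, ha, rfl⟩ := hx
    obtain ⟨m, b, hb, rfl⟩ := hy
    exact ⟨n + m, a + b, add_mem ha hb, by push_cast; rw [add_smul]; abel⟩

lemma reflIso_simple_mem_posR (hR : IsRootSystem R) (hv : ∀ α ∈ R, ⟪v, α⟫_ℝ ≠ 0) {α β : E}
    (hα : α ∈ simpleR R v) (hβ : β ∈ posR R v) (hne : ∀ t : ℝ, β ≠ t • α) :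
    reflIso α β ∈ posR R v := by
  have hαR := (mem_posR.mp hα.1).1
  have hα0 := hR.ne_zero hαR
  have hv0 := (mem_posR.mp hα.1).2
  refine (hR.mem_posR_or_neg hv (hR.reflIso_mem hαR (mem_posR.mp hβ).1)).resolve_right fun hneg => ?_
  obtain ⟨n, y, hy, hβy⟩ := exists_nsmul_add_of_mem_closure α (mem_closure_simpleR β hβ)
  obtain ⟨m, z, hz, hγz⟩ := exists_nsmul_add_of_mem_closure α (mem_closure_simpleR _ hneg)
  have hα_inner : ∀ x ∈ AddSubmonoid.closure (simpleR R v \ {α}), ⟪α, x⟫_ℝ ≤ 0 := by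
    intro x hx
    induction hx using AddSubmonoid.closure_induction with
    | mem x hx => exact hR.inner_simple_nonpos hv hα hx.1 (fun h => hx.2 h.symm)
    | zero => simp
    | add x y _ _ hx hy => rw [inner_add_right]; linarith
  have hv_inner : ∀ x ∈ AddSubmonoid.closure (simpleR R v \ {α}), x = 0 ∨ 0 < ⟪v, x⟫_ℝ := by
    intro x hx
    induction hx using AddSubmonoid.closure_induction with
    | mem x hx => exact Or.inr (mem_posR.mp hx.1.1).2
    | zero => simp
    | add x y _ _ hx hy =>
      rcases hx with rfl | hx
      · simpa using hy
      · rcases hy with rfl | hy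
        · right; simpa using hx
        · right; rw [inner_add_right]; linarith
  have hsum : y + z = (coPair β α - n - m) • α := by
    rw [reflIso_apply, sRefl] at hγz
    have h1 : y = β - (n : ℝ) • α := by rw [hβy]; abel
    have h2 : z = -(β - coPair β α • α) - (m : ℝ) • α := by rw [hγz]; abel
    rw [h1, h2, sub_smul, sub_smul]
    abel
  have hyv : 0 < ⟪v, y⟫_ℝ := by
    refine (hv_inner y hy).resolve_left ?_
    rintro rfl
    exact hne n (by simpa using hβy)
  have hzv : 0 ≤ ⟪v, z⟫_ℝ := by
    rcases hv_inner z hz with rfl | h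
    · simp
    · exact h.le
  have e1 := congrArg (fun x => ⟪v, x⟫_ℝ) hsum
  have e2 := congrArg (fun x => ⟪α, x⟫_ℝ) hsum
  simp only [inner_add_right, real_inner_smul_right] at e1 e2
  have hc : 0 < coPair β α - n - m := by
    refine pos_of_mul_pos_left ?_ hv0.le
    linarith
  have := mul_pos hc (real_inner_self_pos.mpr hα0)
  linarith [hα_inner y hy, hα_inner z hz]

lemma eq_one_or_two_of_smul_mem (hR : IsRootSystem R) {α : E} (hα : α ∈ simpleR R v) {t : ℝ}
    (ht : 0 < t) (h : t • α ∈ R) : t = 1 ∨ t = 2 := by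
  have hαR := (mem_posR.mp hα.1).1
  have hα0 := hR.ne_zero hαR
  obtain ⟨p, hp⟩ := hR.crystallographic α hαR _ h
  obtain ⟨q, hq⟩ := hR.crystallographic _ h α hαR
  rw [coPair_smul, coPair_self hα0] at hp
  have hq' : 2 = (q : ℝ) * t := by
    have h1 := coPair_mul_inner_self (hR.ne_zero h) α
    rw [hq, real_inner_smul_left, real_inner_smul_right] at h1
    have h2 : ⟪α, α⟫_ℝ ≠ 0 := inner_self_ne_zero.mpr hα0
    have h3 : (2 - q * t) * (t * ⟪α, α⟫_ℝ) = 0 := by linarith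
    have := (mul_eq_zero.mp h3).resolve_right (mul_ne_zero ht.ne' h2)
    linarith
  have hpq : p * q = 4 := by
    have : (p : ℝ) * q = 4 := by rw [← hp]; linarith
    exact_mod_cast this
  have hp0 : 0 < p := by
    have : (0 : ℝ) < p := by linarith
    exact_mod_cast this
  have hle : p ≤ 4 := Int.le_of_dvd (by norm_num) ⟨q, hpq.symm⟩
  have hhalf : p ≠ 1 := by
    rintro rfl
    have ht2 : t = 1 / 2 := by push_cast at hp; linarith
    have hpos : t • α ∈ posR R v :=
      mem_posR.mpr ⟨h, by rw [real_inner_smul_right]; exact mul_pos ht (mem_posR.mp hα.1).2⟩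
    refine hα.2 _ hpos _ hpos ?_
    rw [← add_smul, ht2]; norm_num
  interval_cases p
  · exact absurd rfl hhalf
  · left; push_cast at hp; linarith
  · omega
  · right; push_cast at hp; linarith

lemma exists_nat_coPair_rhoR (hR : IsRootSystem R) (hv : ∀ α ∈ R, ⟪v, α⟫_ℝ ≠ 0) :
    IsSimplyDominant R v (rhoR R v) := by
  intro α hα
  have hαR := (mem_posR.mp hα.1).1
  have hα0 := hR.ne_zero hαR
  rw [rhoR, coPair_smul, coPair_sum,
    ← Finset.sum_filter_add_sum_filter_not _ (fun β => ∃ t : ℝ, β = t • α)]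
  have h1 : ∑ β ∈ (posR R v).filter (fun β => ¬ ∃ t : ℝ, β = t • α), coPair β α = 0 := by
    refine Finset.sum_involution (fun β _ => reflIso α β) ?_ ?_ ?_ ?_
    · intro β _
      rw [coPair_reflIso hα0]; ring
    · intro β _ h heq
      have := coPair_reflIso hα0 β
      rw [heq] at this
      exact h (by linarith)
    · intro β hβ
      simp only [Finset.mem_filter, not_exists] at hβ ⊢
      refine ⟨hR.reflIso_simple_mem_posR hv hα hβ.1 hβ.2, fun t ht => hβ.2 (-t) ?_⟩
      rw [← reflIso_involutive α β, ht, map_smul, reflIso_self hα0, smul_neg, neg_smul]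
    · intro β _
      exact reflIso_involutive α β
  have h2 : ∃ n : ℕ,
      ∑ β ∈ (posR R v).filter (fun β => ∃ t : ℝ, β = t • α), coPair β α = 2 * n := by
    refine Finset.sum_induction _ (fun x : ℝ => ∃ n : ℕ, x = 2 * n) ?_ ⟨0, by simp⟩ ?_
    · rintro _ _ ⟨a, rfl⟩ ⟨b, rfl⟩
      exact ⟨a + b, by push_cast; ring⟩
    · intro β hβ
      obtain ⟨hβ, t, rfl⟩ := Finset.mem_filter.mp hβ
      obtain ⟨hβR, hpos⟩ := mem_posR.mp hβ
      rw [real_inner_smul_right] at hpos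
      have ht : 0 < t := pos_of_mul_pos_left hpos (mem_posR.mp hα.1).2.le
      rw [coPair_smul, coPair_self hα0]
      rcases hR.eq_one_or_two_of_smul_mem hα ht hβR with rfl | rfl
      · exact ⟨1, by norm_num⟩
      · exact ⟨2, by norm_num⟩
  obtain ⟨n, hn⟩ := h2
  exact ⟨n, by rw [h1, hn]; ring⟩

lemma simplyDominant_add_rhoR (hR : IsRootSystem R) (hv : ∀ α ∈ R, ⟪v, α⟫_ℝ ≠ 0) {x : E}
    (hx : IsDominant R v x) : IsSimplyDominant R v (x + rhoR R v) := by
  intro α hα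
  obtain ⟨n, hn⟩ := hR.exists_nat_coPair_rhoR hv α hα
  obtain ⟨k, hk⟩ := hx.1 α (mem_posR.mp hα.1).1
  have h0 := hx.2 α hα.1
  rw [hk] at h0
  lift k to ℕ using by exact_mod_cast h0
  exact ⟨k + n, by rw [coPair_add, hn, hk]; push_cast; rfl⟩

lemma wordProd_mem_weyl {L : List E} (hL : ∀ α ∈ L, α ∈ simpleR R v) : wordProd L ∈ Weyl R := by
  induction L with
  | nil => simp
  | cons α L ih =>
    rw [wordProd_cons]
    exact mul_mem (reflIso_mem_weyl (mem_posR.mp (hL α (by simp)).1).1)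
      (ih fun β hβ => hL β (by simp [hβ]))

lemma exists_eq_smul_wordProd (hR : IsRootSystem R) (hv : ∀ α ∈ R, ⟪v, α⟫_ℝ ≠ 0) :
    ∀ β ∈ posR R v, ∃ L : List E, (∀ α ∈ L, α ∈ simpleR R v) ∧ ∃ α ∈ simpleR R v, ∃ t : ℝ,
      0 < t ∧ β = t • wordProd L α := by
  refine posR_induction fun β hβ ih => ?_
  obtain ⟨hβR, hβv⟩ := mem_posR.mp hβ
  by_cases hprop : ∃ α ∈ simpleR R v, ∃ t : ℝ, β = t • α
  · obtain ⟨α, hα, t, rfl⟩ := hprop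
    rw [real_inner_smul_right] at hβv
    exact ⟨[], by simp, α, hα, t, pos_of_mul_pos_left hβv (mem_posR.mp hα.1).2.le, by simp⟩
  · push Not at hprop
    have hex : ∃ α ∈ simpleR R v, 0 < ⟪β, α⟫_ℝ := by
      by_contra! hle
      have : ∀ x ∈ AddSubmonoid.closure (simpleR R v), ⟪β, x⟫_ℝ ≤ 0 := by
        intro x hx
        induction hx using AddSubmonoid.closure_induction with
        | mem x hx => exact hle x hx
        | zero => simp
        | add x y _ _ hx hy => rw [inner_add_right]; linarith
      exact absurd (this β (mem_closure_simpleR β hβ))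
        (not_le.mpr (real_inner_self_pos.mpr (hR.ne_zero hβR)))
    obtain ⟨α, hα, hpos⟩ := hex
    have hα0 := ne_zero_of_mem_posR hα.1
    obtain ⟨L, hL, γ, hγ, t, ht, heq⟩ := ih (reflIso α β)
      (hR.reflIso_simple_mem_posR hv hα hβ (hprop α hα)) (by
        rw [reflIso_apply, sRefl, inner_sub_right, real_inner_smul_right]
        have := mul_pos (coPair_pos hα0 hpos) (mem_posR.mp hα.1).2
        linarith)
    refine ⟨α :: L, by simpa [hα] using hL, γ, hγ, t, ht, ?_⟩
    rw [← reflIso_involutive α β, heq, map_smul]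
    simp

lemma exists_wordProd_eq_reflIso (hR : IsRootSystem R) (hv : ∀ α ∈ R, ⟪v, α⟫_ℝ ≠ 0) {β : E}
    (hβ : β ∈ R) : ∃ L : List E, (∀ α ∈ L, α ∈ simpleR R v) ∧ reflIso β = wordProd L := by
  wlog hpos : β ∈ posR R v generalizing β
  · have h := (hR.mem_posR_or_neg hv hβ).resolve_left hpos
    obtain ⟨L, hL, heq⟩ := this (hR.neg_mem hβ) h
    refine ⟨L, hL, ?_⟩
    rw [← heq, ← neg_one_smul ℝ β, reflIso_smul (by norm_num)]
  obtain ⟨L, hL, α, hα, t, ht, rfl⟩ := hR.exists_eq_smul_wordProd hv β hpos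
  refine ⟨L ++ α :: L.reverse, ?_, ?_⟩
  · intro γ hγ
    simp only [List.mem_append, List.mem_cons, List.mem_reverse] at hγ
    rcases hγ with h | rfl | h
    exacts [hL _ h, hα, hL _ h]
  · rw [reflIso_smul ht.ne', wordProd_append, wordProd_cons, wordProd_reverse, ← mul_assoc,
      ← reflIso_mul_comm, mul_inv_cancel_right]

lemma exists_wordProd_eq (hR : IsRootSystem R) (hv : ∀ α ∈ R, ⟪v, α⟫_ℝ ≠ 0) {w : E ≃ₗᵢ[ℝ] E}
    (hw : w ∈ Weyl R) : ∃ L : List E, (∀ α ∈ L, α ∈ simpleR R v) ∧ w = wordProd L := by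
  have key : ∀ g : E ≃ₗᵢ[ℝ] E, (∃ α ∈ R, ∀ x, g x = sRefl α x) →
      ∃ L : List E, (∀ α ∈ L, α ∈ simpleR R v) ∧ g = wordProd L := by
    rintro g ⟨α, hα, h⟩
    obtain ⟨L, hL, heq⟩ := hR.exists_wordProd_eq_reflIso hv hα
    exact ⟨L, hL, by rw [← heq]; ext x; rw [h, reflIso_apply]⟩
  induction hw using Subgroup.closure_induction with
  | mem g hg => exact key g hg
  | one => exact ⟨[], by simp, rfl⟩
  | mul a b _ _ ha hb =>
    obtain ⟨L, hL, rfl⟩ := ha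
    obtain ⟨M, hM, rfl⟩ := hb
    refine ⟨L ++ M, fun α hα => ?_, (wordProd_append L M).symm⟩
    exact (List.mem_append.mp hα).elim (hL α) (hM α)
  | inv a _ ha =>
    obtain ⟨L, hL, rfl⟩ := ha
    exact ⟨L.reverse, fun α hα => hL α (List.mem_reverse.mp hα), (wordProd_reverse L).symm⟩

/-- The exchange condition. -/
lemma exists_exchange (hR : IsRootSystem R) (hv : ∀ α ∈ R, ⟪v, α⟫_ℝ ≠ 0) {α : E}
    (hα : α ∈ simpleR R v) (L : List E) (hL : ∀ β ∈ L, β ∈ simpleR R v)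
    (hneg : -wordProd L α ∈ posR R v) :
    ∃ M : List E, (∀ β ∈ M, β ∈ simpleR R v) ∧ M.length + 1 = L.length ∧
      wordProd M = wordProd L * reflIso α := by
  induction L with
  | nil =>
    have h1 := (mem_posR.mp hα.1).2
    have h2 := (mem_posR.mp hneg).2
    simp only [wordProd_nil, LinearIsometryEquiv.coe_one, id_eq, inner_neg_right] at h2
    linarith
  | cons σ T ih =>
    have hσ : σ ∈ simpleR R v := hL σ (by simp)
    have hT : ∀ β ∈ T, β ∈ simpleR R v := fun β hβ => hL β (by simp [hβ])
    have hTα : wordProd T α ∈ R :=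
      hR.weyl_map_mem (wordProd_mem_weyl hT) α (mem_posR.mp hα.1).1
    rcases hR.mem_posR_or_neg hv hTα with hpos | hneg'
    · have hprop : ∃ t : ℝ, wordProd T α = t • σ := by
        by_contra! hne
        have h1 := (mem_posR.mp (hR.reflIso_simple_mem_posR hv hσ hpos hne)).2
        have h2 := (mem_posR.mp hneg).2
        simp only [wordProd_cons, LinearIsometryEquiv.coe_mul, Function.comp_apply,
          inner_neg_right] at h2
        linarith
      obtain ⟨t, ht⟩ := hprop
      have ht0 : t ≠ 0 := by
        rintro rfl
        exact hR.ne_zero hTα (by simpa using ht)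
      refine ⟨T, hT, by simp, ?_⟩
      rw [wordProd_cons, mul_assoc, ← reflIso_mul_comm, ht, reflIso_smul ht0, ← mul_assoc,
        reflIso_mul_self, one_mul]
    · obtain ⟨M, hM, hlen, heq⟩ := ih hT hneg'
      refine ⟨σ :: M, by simpa [hσ] using hM, by simp [hlen], ?_⟩
      rw [wordProd_cons, heq, wordProd_cons, mul_assoc]

lemma sub_wordProd_mem_posCone (hR : IsRootSystem R) (hv : ∀ α ∈ R, ⟪v, α⟫_ℝ ≠ 0) {x : E}
    (hx : IsSimplyDominant R v x) (n : ℕ) : ∀ L : List E, L.length = n →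
    (∀ β ∈ L, β ∈ simpleR R v) → x - wordProd L x ∈ posCone R v := by
  induction n using Nat.strong_induction_on with
  | _ n ih =>
    intro L hlen hL
    rcases L.eq_nil_or_concat' with rfl | ⟨M, α, rfl⟩
    · simp
    · have hα : α ∈ simpleR R v := hL α (by simp)
      have hM : ∀ β ∈ M, β ∈ simpleR R v := fun β hβ => hL β (by simp [hβ])
      simp only [List.length_append, List.length_singleton] at hlen
      have hMα : wordProd M α ∈ R :=
        hR.weyl_map_mem (wordProd_mem_weyl hM) α (mem_posR.mp hα.1).1
      rcases hR.mem_posR_or_neg hv hMα with hpos | hneg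
      · have h1 := ih M.length (by omega) M rfl hM
        have h2 := add_mem h1 (natCast_smul_mem_posCone hpos (hx α hα))
        convert h2 using 1
        simp only [wordProd_append, wordProd_cons, wordProd_nil, mul_one,
          LinearIsometryEquiv.coe_mul, Function.comp_apply, reflIso_apply, sRefl, map_sub, map_smul]
        abel
      · obtain ⟨N, hN, hNlen, heq⟩ := hR.exists_exchange hv hα M hM hneg
        have := ih N.length (by omega) N rfl hN
        rw [heq] at this
        simpa using this

lemma sub_weyl_mem_posCone (hR : IsRootSystem R) (hv : ∀ α ∈ R, ⟪v, α⟫_ℝ ≠ 0) {x : E}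
    (hx : IsSimplyDominant R v x) {w : E ≃ₗᵢ[ℝ] E} (hw : w ∈ Weyl R) :
    x - w x ∈ posCone R v := by
  obtain ⟨L, hL, rfl⟩ := hR.exists_wordProd_eq hv hw
  exact hR.sub_wordProd_mem_posCone hv hx _ L rfl hL

lemma exists_int_coPair_wordProd (hR : IsRootSystem R) {x : E}
    (hx : ∀ α ∈ simpleR R v, ∃ n : ℤ, coPair x α = n) (L : List E)
    (hL : ∀ β ∈ L, β ∈ simpleR R v) :
    ∀ α ∈ simpleR R v, ∃ n : ℤ, coPair (wordProd L x) α = n := by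
  induction L with
  | nil => simpa using hx
  | cons σ L ih =>
    intro α hα
    have hσ : σ ∈ simpleR R v := hL σ (by simp)
    have ih' := ih fun β hβ => hL β (by simp [hβ])
    obtain ⟨a, ha⟩ := ih' α hα
    obtain ⟨b, hb⟩ := ih' σ hσ
    obtain ⟨c, hc⟩ := hR.crystallographic α (mem_posR.mp hα.1).1 σ (mem_posR.mp hσ.1).1
    refine ⟨a - b * c, ?_⟩
    rw [wordProd_cons, LinearIsometryEquiv.coe_mul, Function.comp_apply, reflIso_apply, sRefl,
      coPair_sub, coPair_smul, ha, hb, hc]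
    push_cast
    rfl

/-- The points `x - m β` of the `β`-string strictly between a dominant `x` and `s_β x` have all
their Weyl group conjugates below `x`. -/
lemma sub_weyl_string_mem_posCone (hR : IsRootSystem R) (hv : ∀ α ∈ R, ⟪v, α⟫_ℝ ≠ 0) {x : E}
    (hx : IsSimplyDominant R v x) {w : E ≃ₗᵢ[ℝ] E} (hw : w ∈ Weyl R) {β : E}
    (hβ : β ∈ posR R v) {m : ℤ} (hm : 0 < m) (hm' : (m : ℝ) < coPair x β) :
    x - w (x - (m : ℝ) • β) ∈ posCone R v := by
  obtain ⟨L, hL, α, hα, t, ht, rfl⟩ := hR.exists_eq_smul_wordProd hv β hβ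
  have hβR := (mem_posR.mp hβ).1
  have hLW := wordProd_mem_weyl (R := R) hL
  have hγR : wordProd L α ∈ R := hR.weyl_map_mem hLW α (mem_posR.mp hα.1).1
  have htα : t • α ∈ R := by
    have := hR.weyl_map_mem (inv_mem hLW) _ hβR
    rwa [map_smul, inv_apply_apply] at this
  have ht_nat : ∃ k : ℕ, t = k := by
    rcases hR.eq_one_or_two_of_smul_mem hα ht htα with rfl | rfl
    exacts [⟨1, by simp⟩, ⟨2, by simp⟩]
  obtain ⟨k, rfl⟩ := ht_nat
  set γ := wordProd L α with hγ
  have hc : ∃ c : ℤ, coPair x γ = c := by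
    have h := hR.exists_int_coPair_wordProd (v := v) (x := x)
      (fun δ hδ => (hx δ hδ).imp' (fun n : ℕ => (n : ℤ)) (by intro a h; simpa using h))
      L.reverse (fun δ hδ => hL δ (List.mem_reverse.mp hδ)) α hα
    rw [wordProd_reverse, ← coPair_map (wordProd L), ← hγ] at h
    rwa [apply_inv_apply] at h
  obtain ⟨c, hc⟩ := hc
  have hcβ : coPair x ((k : ℝ) • γ) * k = c := by
    rw [← hc]
    have hk := ht.ne'
    simp only [coPair, real_inner_smul_left, real_inner_smul_right]
    field_simp
  have hlt : m * k < c := by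
    have : (m : ℝ) * k < c := by rw [← hcβ]; exact mul_lt_mul_of_pos_right hm' ht
    exact_mod_cast this
  lift m to ℕ using hm.le
  rcases hR.mem_posR_or_neg hv (hR.weyl_map_mem hw γ hγR) with hpos | hneg
  · have h := add_mem (hR.sub_weyl_mem_posCone hv hx hw)
      (natCast_smul_mem_posCone hpos (c := (m : ℝ) * k) ⟨m * k, by push_cast; rfl⟩)
    convert h using 1
    simp only [map_sub, map_smul, smul_smul, Int.cast_natCast]
    abel
  · have h := add_mem (hR.sub_weyl_mem_posCone hv hx (mul_mem hw (reflIso_mem_weyl hγR)))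
      (natCast_smul_mem_posCone hneg (c := (c : ℝ) - m * k) ⟨(c - m * k).toNat, by
        have h1 : ((c - m * k).toNat : ℤ) = c - m * k := Int.toNat_of_nonneg (by omega)
        have h2 : (((c - m * k).toNat : ℤ) : ℝ) = c - m * k := by rw [h1]; push_cast; rfl
        rw [← h2, Int.cast_natCast]⟩)
    convert h using 1
    simp only [LinearIsometryEquiv.coe_mul, Function.comp_apply, reflIso_apply, sRefl, hc,
      map_sub, map_smul, smul_smul, Int.cast_natCast, sub_smul, smul_neg]
    abel

lemma inner_posCone_nonneg {x : E} (hx : IsSimplyDominant R v x) :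
    ∀ y ∈ posCone R v, 0 ≤ ⟪x, y⟫_ℝ := by
  have hs : ∀ y ∈ AddSubmonoid.closure (simpleR R v), 0 ≤ ⟪x, y⟫_ℝ := by
    intro y hy
    induction hy using AddSubmonoid.closure_induction with
    | mem y hy =>
      rw [← coPair_nonneg_iff (ne_zero_of_mem_posR hy.1)]
      obtain ⟨n, hn⟩ := hx y hy
      rw [hn]; positivity
    | zero => simp
    | add y z _ _ hy hz => rw [inner_add_right]; linarith
  intro y hy
  induction hy using AddSubmonoid.closure_induction with
  | mem y hy => exact hs y (mem_closure_simpleR y hy)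
  | zero => simp
  | add y z _ _ hy hz => rw [inner_add_right]; linarith

lemma norm_sq_sub_smul {β : E} (hβ : β ≠ 0) (x : E) (m : ℝ) :
    ‖x - m • β‖ ^ 2 = ‖x‖ ^ 2 - m * (coPair x β - m) * ⟪β, β⟫_ℝ := by
  have h := coPair_mul_inner_self hβ x
  rw [norm_sub_sq_real, norm_smul, mul_pow, real_inner_smul_right, ← real_inner_self_eq_norm_sq β,
    Real.norm_eq_abs, sq_abs]
  linear_combination m * h

lemma norm_sq_sub_smul_lt_iff {β : E} (hβ : β ≠ 0) (x : E) (m : ℝ) :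
    ‖x - m • β‖ ^ 2 < ‖x‖ ^ 2 ↔ 0 < m * (coPair x β - m) := by
  rw [norm_sq_sub_smul hβ, sub_lt_self_iff, mul_pos_iff_of_pos_right (real_inner_self_pos.mpr hβ)]

lemma norm_sq_lt_sub_smul_iff {β : E} (hβ : β ≠ 0) (x : E) (m : ℝ) :
    ‖x‖ ^ 2 < ‖x - m • β‖ ^ 2 ↔ m * (coPair x β - m) < 0 := by
  have h := real_inner_self_pos.mpr hβ
  rw [norm_sq_sub_smul hβ, lt_sub_comm, sub_self, mul_neg_iff]
  constructor
  · rintro (h' | h')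
    · linarith [h'.2]
    · exact h'.1
  · exact fun h' => Or.inr ⟨h', h⟩

lemma coPair_nonneg_of_mem_posR {x : E} (hx : IsSimplyDominant R v x) {β : E}
    (hβ : β ∈ posR R v) : 0 ≤ coPair x β := by
  rw [coPair_nonneg_iff (ne_zero_of_mem_posR hβ)]
  exact inner_posCone_nonneg hx β (AddSubmonoid.subset_closure hβ)

lemma norm_sq_lt_of_domLt (hR : IsRootSystem R) (hv : ∀ α ∈ R, ⟪v, α⟫_ℝ ≠ 0) {lam mu : E}
    (hlam : IsDominant R v lam) (h : domLt R v lam mu) :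
    ‖lam + rhoR R v‖ ^ 2 < ‖mu + rhoR R v‖ ^ 2 := by
  obtain ⟨hne, hc⟩ := h
  have h0 := inner_posCone_nonneg (hR.simplyDominant_add_rhoR hv hlam) _ (mem_posCone_iff.mpr hc)
  have h1 : 0 < ‖mu - lam‖ := norm_pos_iff.mpr (sub_ne_zero.mpr hne.symm)
  have h2 : mu + rhoR R v = (lam + rhoR R v) + (mu - lam) := by abel
  rw [h2, norm_add_sq_real (lam + rhoR R v)]
  nlinarith

lemma domLt_of_norm_sq_lt (hR : IsRootSystem R) (hv : ∀ α ∈ R, ⟪v, α⟫_ℝ ≠ 0) {lam mu : E}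
    (hmu : IsDominant R v mu) {w : E ≃ₗᵢ[ℝ] E} (hw : w ∈ Weyl R) {β : E} (hβ : β ∈ R) {m : ℤ}
    (heq : w (lam + rhoR R v) = mu + rhoR R v - (m : ℝ) • β)
    (hlt : ‖lam + rhoR R v‖ ^ 2 < ‖mu + rhoR R v‖ ^ 2) : domLt R v lam mu := by
  wlog hpos : β ∈ posR R v generalizing β m
  · exact this (hR.neg_mem hβ) (m := -m) (by rw [heq]; simp)
      ((hR.mem_posR_or_neg hv hβ).resolve_left hpos)
  have hmu' := hR.simplyDominant_add_rhoR hv hmu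
  have h0 := coPair_nonneg_of_mem_posR hmu' hpos
  refine ⟨fun h => hlt.ne (by rw [h]), ?_⟩
  rw [← mem_posCone_iff]
  have h1 := hlt
  rw [← w.norm_map, heq, norm_sq_sub_smul_lt_iff (hR.ne_zero hβ)] at h1
  have hm : (0 : ℝ) < m := by
    by_contra! hm
    nlinarith
  have hm' : (m : ℝ) < coPair (mu + rhoR R v) β := by
    have := (pos_iff_pos_of_mul_pos h1).mp hm
    linarith
  have h2 := hR.sub_weyl_string_mem_posCone hv hmu' (inv_mem hw) hpos
    (by exact_mod_cast hm) hm'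
  rw [← heq, inv_apply_apply] at h2
  simpa using h2

lemma domLt_iff_norm_sq_lt (hR : IsRootSystem R) (hv : ∀ α ∈ R, ⟪v, α⟫_ℝ ≠ 0) {lam mu : E}
    (hlam : IsDominant R v lam) (hmu : IsDominant R v mu) {w : E ≃ₗᵢ[ℝ] E} (hw : w ∈ Weyl R)
    {β : E} (hβ : β ∈ R) {m : ℤ}
    (heq : w (lam + rhoR R v) = mu + rhoR R v - (m : ℝ) • β) :
    domLt R v lam mu ↔ ‖lam + rhoR R v‖ ^ 2 < ‖mu + rhoR R v‖ ^ 2 :=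
  ⟨hR.norm_sq_lt_of_domLt hv hlam, hR.domLt_of_norm_sq_lt hv hmu hw hβ heq⟩

lemma dotAct_eq_sub_smul_iff {w : E ≃ₗᵢ[ℝ] E} {lam mu β : E} {m : ℝ} :
    dotAct R v w lam = mu - m • β ↔ w (lam + rhoR R v) = mu + rhoR R v - m • β := by
  rw [dotAct, sub_eq_iff_eq_add, sub_add_eq_add_sub]

lemma mem_VsetB_iff (hR : IsRootSystem R) (hv : ∀ α ∈ R, ⟪v, α⟫_ℝ ≠ 0) {lam mu : E}
    (hlam : IsDominant R v lam) (hmu : IsDominant R v mu) {β : E} (hβ : β ∈ posR R v)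
    {w : E ≃ₗᵢ[ℝ] E} {m : ℤ} :
    (w, m) ∈ VsetB R v lam mu β ↔
      domLt R v lam mu ∧ w ∈ Weyl R ∧ dotAct R v w lam = mu - (m : ℝ) • β := by
  have h0 := coPair_nonneg_of_mem_posR (hR.simplyDominant_add_rhoR hv hmu) hβ
  suffices h : w ∈ Weyl R → dotAct R v w lam = mu - (m : ℝ) • β →
      (domLt R v lam mu ↔ 0 < m ∧ (m : ℝ) < coPair (mu + rhoR R v) β) by
    simp only [VsetB, Set.mem_ofPred_eq]; tauto
  intro hw heq
  rw [dotAct_eq_sub_smul_iff] at heq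
  rw [hR.domLt_iff_norm_sq_lt hv hlam hmu hw (mem_posR.mp hβ).1 heq, ← w.norm_map, heq,
    norm_sq_sub_smul_lt_iff (ne_zero_of_mem_posR hβ), ← Int.cast_pos (R := ℝ)]
  constructor
  · intro h
    have hm : (0 : ℝ) < m := by
      by_contra! hm
      nlinarith
    exact ⟨hm, sub_pos.mp ((pos_iff_pos_of_mul_pos h).mp hm)⟩
  · rintro ⟨h1, h2⟩
    exact mul_pos h1 (sub_pos.mpr h2)

lemma mem_UsetG_iff (hR : IsRootSystem R) (hv : ∀ α ∈ R, ⟪v, α⟫_ℝ ≠ 0) {lam mu : E}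
    (hlam : IsDominant R v lam) (hmu : IsDominant R v mu) {γ : E} (hγ : γ ∈ posR R v)
    {w : E ≃ₗᵢ[ℝ] E} {n : ℤ} :
    (w, n) ∈ UsetG R v lam mu γ ↔
      domLt R v lam mu ∧ w ∈ Weyl R ∧ dotAct R v w mu = lam - (n : ℝ) • γ := by
  have h0 := coPair_nonneg_of_mem_posR (hR.simplyDominant_add_rhoR hv hlam) hγ
  suffices h : w ∈ Weyl R → dotAct R v w mu = lam - (n : ℝ) • γ →
      (domLt R v lam mu ↔ n < 0 ∨ coPair (lam + rhoR R v) γ < (n : ℝ)) by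
    simp only [UsetG, Set.mem_ofPred_eq]; tauto
  intro hw heq
  rw [dotAct_eq_sub_smul_iff] at heq
  have hγ' : w⁻¹ γ ∈ R := hR.weyl_map_mem (inv_mem hw) γ (mem_posR.mp hγ).1
  have heq' : w⁻¹ (lam + rhoR R v) = mu + rhoR R v - ((-n : ℤ) : ℝ) • w⁻¹ γ := by
    rw [← inv_apply_apply w (mu + rhoR R v), heq, ← map_smul, ← map_sub]
    simp
  rw [hR.domLt_iff_norm_sq_lt hv hlam hmu (inv_mem hw) hγ' heq', ← w.norm_map (mu + _), heq,
    norm_sq_lt_sub_smul_iff (ne_zero_of_mem_posR hγ), ← Int.cast_lt_zero (R := ℝ)]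
  constructor
  · intro h
    by_contra! hcon
    nlinarith [mul_nonneg hcon.1 (sub_nonneg.mpr hcon.2)]
  · rintro (h | h) <;> nlinarith

end IsRootSystem

theorem statement0 [FiniteDimensional ℝ E] (R : Finset E) (hR : IsRootSystem R)
    (v : E) (hv : ∀ α ∈ R, ⟪v, α⟫_ℝ ≠ 0)
    (lam mu : E) (hlam : IsDominant R v lam) (hmu : IsDominant R v mu) :
    (¬ domLt R v lam mu → Uset R v lam mu = ∅ ∧ Vset R v lam mu = ∅) ∧
    (domLt R v lam mu →
      Uset R v lam mu = {t | t.1 ∈ posR R v ∧ t.2.1 ∈ Weyl R ∧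
          dotAct R v t.2.1 mu = lam - (t.2.2 : ℝ) • t.1} ∧
      Vset R v lam mu = {t | t.1 ∈ posR R v ∧ t.2.1 ∈ Weyl R ∧
          dotAct R v t.2.1 lam = mu - (t.2.2 : ℝ) • t.1}) := by
  have hU : ∀ t, t ∈ Uset R v lam mu ↔ domLt R v lam mu ∧ t.1 ∈ posR R v ∧ t.2.1 ∈ Weyl R ∧
      dotAct R v t.2.1 mu = lam - (t.2.2 : ℝ) • t.1 := fun t => by
    have := fun h => hR.mem_UsetG_iff hv hlam hmu (γ := t.1) h (w := t.2.1) (n := t.2.2)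
    simp only [Uset, Set.mem_ofPred_eq]
    tauto
  have hV : ∀ t, t ∈ Vset R v lam mu ↔ domLt R v lam mu ∧ t.1 ∈ posR R v ∧ t.2.1 ∈ Weyl R ∧
      dotAct R v t.2.1 lam = mu - (t.2.2 : ℝ) • t.1 := fun t => by
    have := fun h => hR.mem_VsetB_iff hv hlam hmu (β := t.1) h (w := t.2.1) (m := t.2.2)
    simp only [Vset, Set.mem_ofPred_eq]
    tauto
  refine ⟨fun h => ⟨?_, ?_⟩, fun h => ⟨?_, ?_⟩⟩
  · exact Set.eq_empty_of_forall_notMem fun t ht => h ((hU t).mp ht).1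
  · exact Set.eq_empty_of_forall_notMem fun t ht => h ((hV t).mp ht).1
  · ext t; rw [hU t]; exact and_iff_right h
  · ext t; rw [hV t]; exact and_iff_right h

end
end

section
/- Let k be a field of characteristic p, where p is an odd prime, let l ≥ 3 be an odd integer, and let q ∈ k be a root of unity whose multiplicative order is l or 2l. For every integer m ≥ 1, the multiplicity of q as a root of the polynomial P_m(X) = 1 + X² + X⁴ + ⋯ + X^{2(m−1)} ∈ k[X] equals p^{ν_p(m)} if l divides m, and 0 otherwise, where ν_p(m) is the p-adic valuation of m. -/
open Polynomial

/-- In characteristic `p`, the multiplicity of `q` as a root of `X ^ n - 1` with `n ≠ 0` is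
`p ^ ν_p(n)` if `q ^ n = 1`, and `0` otherwise. -/
theorem rootMultiplicity_X_pow_sub_one {k : Type*} [Field k] {p : ℕ} (hp : p.Prime) [CharP k p]
    [DecidableEq k] (q : k) {n : ℕ} (hn : n ≠ 0) :
    (X ^ n - 1 : k[X]).rootMultiplicity q = if q ^ n = 1 then p ^ padicValNat p n else 0 := by
  have : Fact p.Prime := ⟨hp⟩
  have : ExpChar k p := ExpChar.prime hp
  split_ifs with hq
  · obtain ⟨a, d, hd, rfl⟩ := Nat.exists_eq_pow_mul_and_not_dvd hn p hp.ne_one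
    have hd0 : d ≠ 0 := by rintro rfl; simp at hd
    have hsep : (X ^ d - 1 : k[X]).Separable :=
      X_pow_sub_one_separable_iff.2 fun h => hd ((CharP.cast_eq_zero_iff k p d).1 h)
    have hexp : (X ^ (p ^ a * d) - 1 : k[X]) = expand k (p ^ a) (X ^ d - 1) := by
      simp [pow_mul]
    have hone : (X ^ d - 1 : k[X]).rootMultiplicity (q ^ p ^ a) = 1 := by
      refine le_antisymm (rootMultiplicity_le_one_of_separable hsep _) ?_
      refine (rootMultiplicity_pos hsep.ne_zero).2 ?_
      simp [← pow_mul, hq]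
    rw [hexp, rootMultiplicity_expand_pow, hone, mul_one,
      padicValNat.mul (pow_ne_zero _ hp.ne_zero) hd0, padicValNat.prime_pow,
      padicValNat.eq_zero_of_not_dvd hd, add_zero]
  · exact rootMultiplicity_eq_zero (by simpa [sub_eq_zero] using hq)

theorem statement9 (k : Type*) [Field k] (p : ℕ) (hp : p.Prime) (hodd : Odd p)
    [CharP k p] (l : ℕ) (hl : 3 ≤ l) (hlodd : Odd l) (q : k)
    (hq : orderOf q = l ∨ orderOf q = 2 * l)
    (m : ℕ) (hm : 1 ≤ m) :
    (∑ j ∈ Finset.range m, (X : k[X]) ^ (2 * j)).rootMultiplicity q =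
      if l ∣ m then p ^ padicValNat p m else 0 := by
  classical
  have : Fact p.Prime := ⟨hp⟩
  have hpow (n : ℕ) : q ^ (2 * n) = 1 ↔ l ∣ n := by
    rw [← orderOf_dvd_iff_pow_eq_one]
    rcases hq with h | h <;> rw [h]
    · exact hlodd.coprime_two_right.dvd_mul_left
    · exact Nat.mul_dvd_mul_iff_left two_pos
  have hgeom : (∑ j ∈ Finset.range m, (X : k[X]) ^ (2 * j)) * (X ^ 2 - 1) = X ^ (2 * m) - 1 := by
    simpa only [pow_mul] using geom_sum_mul (X ^ 2 : k[X]) m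
  have hm0 : 2 * m ≠ 0 := by lia
  have hne : (X ^ (2 * m) - 1 : k[X]) ≠ 0 := X_pow_sub_C_ne_zero (Nat.pos_of_ne_zero hm0) 1
  have hq2 : (X ^ 2 - 1 : k[X]).rootMultiplicity q = 0 := by
    rw [rootMultiplicity_X_pow_sub_one hp q two_ne_zero, if_neg]
    intro h
    have := Nat.le_of_dvd one_pos ((hpow 1).1 h)
    lia
  have hval : padicValNat p (2 * m) = padicValNat p m := by
    have hp2 : ¬p ∣ 2 := fun h => by
      rw [(Nat.prime_dvd_prime_iff_eq hp Nat.prime_two).1 h] at hodd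
      exact absurd hodd (by decide)
    rw [padicValNat.mul two_ne_zero (by lia), padicValNat.eq_zero_of_not_dvd hp2, zero_add]
  have hmul := rootMultiplicity_mul (x := q) (hgeom ▸ hne)
  rw [hgeom, hq2, add_zero, rootMultiplicity_X_pow_sub_one hp q hm0, hval] at hmul
  simpa only [hpow] using hmul.symm
end

section
/- (Type A uniqueness.) In the type A setting, if (i,j) ∈ S(a,b) then D_ab = {a_i, a_j}; consequently S(a,b) contains at most one pair, i.e., the positive root γ = ε_i − ε_j satisfying condition (7.1) is uniquely determined by a and b. -/
/-- The multiset of values of `a`. -/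
def msetOf {m : ℕ} (a : Fin m → ℤ) : Multiset ℤ := Finset.univ.val.map a

/-- Replace `a i` by `a i − n` and `a j` by `a j + n`
(i.e. subtract `n(ε_i − ε_j)` from `a`). -/
def modA {m : ℕ} (a : Fin m → ℤ) (i j : Fin m) (n : ℤ) : Fin m → ℤ :=
  Function.update (Function.update a i (a i - n)) j (a j + n)

/-- `(i,j) ∈ S(a,b)`: `i < j` and for some `n ∈ ℤ` the multiset obtained from the
values of `a` by replacing `a i` with `a i − n` and `a j` with `a j + n` equals
the multiset of values of `b`. -/
def SA {m : ℕ} (a b : Fin m → ℤ) (i j : Fin m) : Prop :=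
  i < j ∧ ∃ n : ℤ, msetOf (modA a i j n) = msetOf b

theorem mem_range_iff_of_msetOf_eq {m : ℕ} {b c : Fin m → ℤ} (h : msetOf c = msetOf b) (x : ℤ) :
    (∃ k, c k = x) ↔ ∃ k, b k = x := by
  have := congrArg (x ∈ ·) h
  simpa [msetOf] using this

theorem modA_eq {m : ℕ} (a : Fin m → ℤ) (i j : Fin m) (n : ℤ) (k : Fin m) :
    modA a i j n k = if k = j then a j + n else if k = i then a i - n else a k := by
  simp only [modA, Function.update_apply]

theorem StrictAnti.eq_of_mem_range_iff {m : ℕ} {a b : Fin m → ℤ} (ha : StrictAnti a)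
    (hb : StrictAnti b) (h : ∀ x, (∃ k, a k = x) ↔ ∃ k, b k = x) : a = b := by
  have hr : Set.range (OrderDual.toDual ∘ a) = Set.range (OrderDual.toDual ∘ b) := by
    rw [Set.range_comp, Set.range_comp]
    exact congrArg _ (Set.ext h)
  exact (StrictMono.range_inj ha.dual_right hb.dual_right).1 hr

theorem exists_modA_eq_iff {m : ℕ} {a : Fin m → ℤ} {i j : Fin m} {n : ℤ} (hij : i ≠ j)
    (hn : n = 0 ∨ n = a i - a j) (x : ℤ) : (∃ k, modA a i j n k = x) ↔ ∃ k, a k = x := by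
  simp only [modA_eq]
  rcases hn with rfl | rfl
  · refine exists_congr fun k => ?_
    split_ifs <;> simp_all
  · refine (Equiv.swap i j).exists_congr fun k => ?_
    rw [Equiv.swap_apply_def]
    split_ifs <;> simp_all

theorem SA.sdiff_eq {m : ℕ} {a b : Fin m → ℤ} (ha : StrictAnti a) (hb : StrictAnti b)
    (hab : a ≠ b) {i j : Fin m} (h : SA a b i j) :
    Finset.image a Finset.univ \ Finset.image b Finset.univ = {a i, a j} := by
  obtain ⟨hij, n, hn⟩ := h
  have hmem := mem_range_iff_of_msetOf_eq hn
  have hn' : ¬(n = 0 ∨ n = a i - a j) := fun h0 => hab <|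
    ha.eq_of_mem_range_iff hb fun x => (exists_modA_eq_iff hij.ne h0 x).symm.trans (hmem x)
  ext x
  simp only [Finset.mem_sdiff, Finset.mem_image, Finset.mem_univ, true_and, Finset.mem_insert,
    Finset.mem_singleton, ← hmem, modA_eq]
  constructor
  · rintro ⟨⟨k, rfl⟩, hk⟩
    by_contra! hne
    refine hk ⟨k, ?_⟩
    rw [if_neg (ne_of_apply_ne a hne.2), if_neg (ne_of_apply_ne a hne.1)]
  · rintro (rfl | rfl)
    all_goals
      refine ⟨⟨_, rfl⟩, ?_⟩
      rintro ⟨k, hk⟩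
      split_ifs at hk with h1 h2
      · exact hn' (by omega)
      · exact hn' (by omega)
      · have := ha.injective hk
        tauto

theorem statement10 (m : ℕ) (hm : 2 ≤ m) (a b : Fin m → ℤ)
    (ha : StrictAnti a) (hb : StrictAnti b)
    (hsum : ∑ i, a i = ∑ i, b i) (hab : a ≠ b) :
    (∀ i j : Fin m, SA a b i j →
      Finset.image a Finset.univ \ Finset.image b Finset.univ = {a i, a j}) ∧
    ∀ i j i' j' : Fin m, SA a b i j → SA a b i' j' → i = i' ∧ j = j' := by
  refine ⟨fun i j h => h.sdiff_eq ha hb hab, fun i j i' j' h h' => ?_⟩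
  have heq : ({a i, a j} : Finset ℤ) = {a i', a j'} :=
    (h.sdiff_eq ha hb hab).symm.trans (h'.sdiff_eq ha hb hab)
  have hi : a i = a i' ∨ a i = a j' := by simpa using (Finset.ext_iff.1 heq (a i)).1 (by simp)
  have hj : a j = a i' ∨ a j = a j' := by simpa using (Finset.ext_iff.1 heq (a j)).1 (by simp)
  simp only [ha.injective.eq_iff] at hi hj
  have := h.1
  have := h'.1
  omega
end

section
/- (Type A nonemptiness criterion.) In the type A setting, S(a,b) is nonempty if and only if |D_ab| = 2 (equivalently |D_ab| = |D_ba| = 2). Moreover, when this holds, writing D_ab = {a_i, a_j} with i < j and D_ba = {b_c, b_d}, one automatically has a_i + a_j = b_c + b_d, and the admissible values of n for the unique pair (i,j) ∈ S(a,b) are exactly n = a_i − b_c (= b_d − a_j) and n = a_i − b_d (= b_c − a_j). -/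
theorem msetOf_update_add {m : ℕ} (f : Fin m → ℤ) (i : Fin m) (x : ℤ) :
    msetOf (Function.update f i x) + {f i} = msetOf f + {x} := by
  have h : (Finset.univ : Finset (Fin m)).val = i ::ₘ (Finset.univ.erase i).val := by
    rw [Finset.erase_val, Multiset.cons_erase (Finset.mem_univ_val i)]
  have h' : (Finset.univ.erase i).val.map (Function.update f i x) =
      (Finset.univ.erase i).val.map f :=
    Multiset.map_congr rfl fun k hk =>
      Function.update_of_ne (Finset.ne_of_mem_erase (Finset.mem_def.2 hk)) _ _
  simp only [msetOf, h, Multiset.map_cons, h', Function.update_self]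
  simp only [← Multiset.singleton_add]
  abel

theorem msetOf_modA_add {m : ℕ} (a : Fin m → ℤ) {i j : Fin m} (hij : i ≠ j) (n : ℤ) :
    msetOf (modA a i j n) + {a i, a j} = msetOf a + {a i - n, a j + n} := by
  have h₁ := msetOf_update_add a i (a i - n)
  have h₂ := msetOf_update_add (Function.update a i (a i - n)) j (a j + n)
  rw [Function.update_of_ne hij.symm] at h₂
  simp only [Multiset.insert_eq_cons, ← Multiset.singleton_add]
  calc _ = msetOf (modA a i j n) + {a j} + {a i} := by abel
    _ = msetOf (Function.update a i (a i - n)) + {a i} + {a j + n} := by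
      rw [modA, h₂]; abel
    _ = _ := by rw [h₁]; abel

theorem msetOf_eq_image_val {m : ℕ} {a : Fin m → ℤ} (ha : Function.Injective a) :
    msetOf a = (Finset.image a Finset.univ).val :=
  (Finset.image_val_of_injOn ha.injOn).symm

theorem msetOf_sum {m : ℕ} (a : Fin m → ℤ) : (msetOf a).sum = ∑ i, a i := rfl

theorem val_add_sdiff_val_comm {α : Type*} [DecidableEq α] (s t : Finset α) :
    s.val + (t \ s).val = t.val + (s \ t).val := by
  ext x
  simp only [Multiset.count_add, Finset.sdiff_val, Multiset.count_sub]
  omega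

theorem StrictAnti.eq_of_image_univ_eq {m : ℕ} {a b : Fin m → ℤ}
    (ha : StrictAnti a) (hb : StrictAnti b)
    (h : Finset.image a Finset.univ = Finset.image b Finset.univ) : a = b := by
  have h' : Set.range a = Set.range b := by
    simpa using congrArg (fun s : Finset ℤ => (s : Set ℤ)) h
  exact (ha.range_inj hb).1 h'

/-- If the set differences of the values of `a` and `b` are pairs, these have the same sum, and
modifying `a` at the first pair gives `b` exactly when the second pair is created. -/
theorem msetOf_modA_eq_iff {m : ℕ} {a b : Fin m → ℤ} (ha : StrictAnti a) (hb : StrictAnti b)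
    (hsum : ∑ i, a i = ∑ i, b i) {i j c d : Fin m} (hij : i < j)
    (hi : Finset.image a Finset.univ \ Finset.image b Finset.univ = {a i, a j})
    (hc : Finset.image b Finset.univ \ Finset.image a Finset.univ = {b c, b d}) :
    a i + a j = b c + b d ∧
      ∀ n : ℤ, (msetOf (modA a i j n) = msetOf b ↔ (n = a i - b c ∨ n = a i - b d)) := by
  have hA := msetOf_eq_image_val ha.injective
  have hB := msetOf_eq_image_val hb.injective
  have haij : a i ≠ a j := (ha hij).ne'
  have hcard : (Finset.image b Finset.univ \ Finset.image a Finset.univ).card =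
      (Finset.image a Finset.univ \ Finset.image b Finset.univ).card :=
    Finset.card_sdiff_comm (by
      rw [Finset.card_image_of_injective _ ha.injective,
        Finset.card_image_of_injective _ hb.injective])
  have hbcd : b c ≠ b d := by
    intro h
    rw [hi, hc, Finset.card_pair haij, h, Finset.pair_eq_singleton, Finset.card_singleton] at hcard
    omega
  have key := val_add_sdiff_val_comm (Finset.image a Finset.univ) (Finset.image b Finset.univ)
  rw [← hA, ← hB, hi, hc, Finset.insert_val_of_notMem (by simpa using hbcd),
    Finset.insert_val_of_notMem (by simpa using haij), Finset.singleton_val,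
    Finset.singleton_val] at key
  have hs : a i + a j = b c + b d := by
    have := congrArg Multiset.sum key
    simp only [Multiset.sum_add, msetOf_sum, Multiset.sum_cons, Multiset.sum_singleton] at this
    linarith
  refine ⟨hs, fun n => ?_⟩
  have hmod := msetOf_modA_add a hij.ne n
  simp only [Multiset.insert_eq_cons] at hmod
  rw [← add_left_inj (a i ::ₘ {a j}), hmod, ← key, add_right_inj]
  constructor
  · intro h
    have : a i - n ∈ b c ::ₘ {b d} := h ▸ Multiset.mem_cons_self _ _
    simp only [Multiset.mem_cons, Multiset.mem_singleton] at this
    omega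
  · rintro (rfl | rfl)
    · rw [show a i - (a i - b c) = b c by ring, show a j + (a i - b c) = b d by linarith]
    · rw [show a i - (a i - b d) = b d by ring, show a j + (a i - b d) = b c by linarith]
      exact Multiset.pair_comm _ _

theorem card_image_sdiff_of_SA {m : ℕ} {a b : Fin m → ℤ} (ha : StrictAnti a) (hb : StrictAnti b)
    (hsum : ∑ i, a i = ∑ i, b i) (hab : a ≠ b) {i j : Fin m} (h : SA a b i j) :
    (Finset.image a Finset.univ \ Finset.image b Finset.univ).card = 2 := by
  obtain ⟨hij, n, hn⟩ := h
  have hA := msetOf_eq_image_val ha.injective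
  have hB := msetOf_eq_image_val hb.injective
  have hcardAB : (Finset.image a Finset.univ).card = (Finset.image b Finset.univ).card := by
    rw [Finset.card_image_of_injective _ ha.injective,
      Finset.card_image_of_injective _ hb.injective]
  have hmod := msetOf_modA_add a hij.ne n
  rw [hn, hA, hB] at hmod
  have hsub : Finset.image a Finset.univ \ Finset.image b Finset.univ ⊆ {a i, a j} := by
    intro x hx
    rw [Finset.mem_sdiff] at hx
    have : x ∈ (Finset.image b Finset.univ).val + {a i, a j} :=
      hmod ▸ Multiset.mem_add.2 (Or.inl hx.1)
    rcases Multiset.mem_add.1 this with h | h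
    · exact absurd h hx.2
    · simpa using h
  have hle := (Finset.card_le_card hsub).trans Finset.card_le_two
  have h0 : (Finset.image a Finset.univ \ Finset.image b Finset.univ).card ≠ 0 := by
    intro h
    rw [Finset.card_eq_zero, Finset.sdiff_eq_empty_iff_subset] at h
    exact hab (ha.eq_of_image_univ_eq hb (Finset.eq_of_subset_of_card_le h hcardAB.ge))
  have h1 : (Finset.image a Finset.univ \ Finset.image b Finset.univ).card ≠ 1 := by
    intro h
    have h' := (Finset.card_sdiff_comm hcardAB).symm.trans h
    obtain ⟨x, hx⟩ := Finset.card_eq_one.1 h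
    obtain ⟨y, hy⟩ := Finset.card_eq_one.1 h'
    have key := val_add_sdiff_val_comm (Finset.image a Finset.univ) (Finset.image b Finset.univ)
    rw [← hA, ← hB, hx, hy] at key
    have hs := congrArg Multiset.sum key
    simp only [Multiset.sum_add, msetOf_sum, Finset.singleton_val, Multiset.sum_singleton] at hs
    have hxy : x = y := by linarith
    have hxm := Finset.mem_sdiff.1 (hx ▸ Finset.mem_singleton_self x)
    have hym := Finset.mem_sdiff.1 (hy ▸ Finset.mem_singleton_self y)
    exact hxm.2 (hxy ▸ hym.1)
  omega

/-- A two-element difference of images is a pair of values. -/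
theorem exists_image_sdiff_eq_pair {m : ℕ} {a b : Fin m → ℤ}
    (h : (Finset.image a Finset.univ \ Finset.image b Finset.univ).card = 2) :
    ∃ i j, i < j ∧ Finset.image a Finset.univ \ Finset.image b Finset.univ = {a i, a j} := by
  obtain ⟨x, y, hxy, he⟩ := Finset.card_eq_two.1 h
  have hx : x ∈ Finset.image a Finset.univ \ Finset.image b Finset.univ := by simp [he]
  have hy : y ∈ Finset.image a Finset.univ \ Finset.image b Finset.univ := by simp [he]
  obtain ⟨i, -, rfl⟩ := Finset.mem_image.1 (Finset.mem_sdiff.1 hx).1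
  obtain ⟨j, -, rfl⟩ := Finset.mem_image.1 (Finset.mem_sdiff.1 hy).1
  rcases lt_trichotomy i j with hij | rfl | hij
  · exact ⟨i, j, hij, he⟩
  · exact absurd rfl hxy
  · exact ⟨j, i, hij, he.trans (Finset.pair_comm _ _)⟩


theorem statement11 (m : ℕ) (hm : 2 ≤ m) (a b : Fin m → ℤ)
    (ha : StrictAnti a) (hb : StrictAnti b)
    (hsum : ∑ i, a i = ∑ i, b i) (hab : a ≠ b) :
    ((∃ i j, SA a b i j) ↔
      (Finset.image a Finset.univ \ Finset.image b Finset.univ).card = 2) ∧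
    ∀ i j c d : Fin m, i < j →
      Finset.image a Finset.univ \ Finset.image b Finset.univ = {a i, a j} →
      Finset.image b Finset.univ \ Finset.image a Finset.univ = {b c, b d} →
      a i + a j = b c + b d ∧ SA a b i j ∧
        ∀ n : ℤ, (msetOf (modA a i j n) = msetOf b ↔ (n = a i - b c ∨ n = a i - b d)) := by
  have hpair : ∀ i j c d : Fin m, i < j →
      Finset.image a Finset.univ \ Finset.image b Finset.univ = {a i, a j} →
      Finset.image b Finset.univ \ Finset.image a Finset.univ = {b c, b d} →
      a i + a j = b c + b d ∧ SA a b i j ∧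
        ∀ n : ℤ, (msetOf (modA a i j n) = msetOf b ↔ (n = a i - b c ∨ n = a i - b d)) := by
    intro i j c d hij hi hc
    obtain ⟨hs, hn⟩ := msetOf_modA_eq_iff ha hb hsum hij hi hc
    exact ⟨hs, ⟨hij, a i - b c, (hn _).2 (Or.inl rfl)⟩, hn⟩
  refine ⟨⟨fun ⟨i, j, h⟩ => card_image_sdiff_of_SA ha hb hsum hab h, fun h => ?_⟩, hpair⟩
  have h' : (Finset.image b Finset.univ \ Finset.image a Finset.univ).card = 2 := by
    rw [← h]
    apply Finset.card_sdiff_comm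
    rw [Finset.card_image_of_injective _ ha.injective,
      Finset.card_image_of_injective _ hb.injective]
  obtain ⟨i, j, hij, hi⟩ := exists_image_sdiff_eq_pair h
  obtain ⟨c, d, -, hc⟩ := exists_image_sdiff_eq_pair h'
  exact ⟨i, j, (hpair i j c d hij hi hc).2.1⟩
end

section
/- (Type B, two-element difference sets.) In the type B setting, suppose |D_ab| = 2, say D_ab = {a_p, a_q} with p < q and D_ba = {b_c, b_d} with b_c > b_d. Then: the positive root ε_p − ε_q belongs to S(a,b) if and only if a_p + a_q = b_c + b_d or a_p + a_q = b_c − b_d; the positive root ε_p + ε_q belongs to S(a,b) if and only if a_p − a_q = b_c + b_d or a_p − a_q = b_c − b_d; no other positive root of B_m belongs to S(a,b); and consequently S(a,b) contains at most one element. -/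
/-- the standard basis vector `ε_s` of `ℚ^m`. -/
def epsB (m : ℕ) (s : Fin m) : Fin m → ℚ := Pi.single s 1

/-- `γ ∈ S(a,b)`: for some `n ∈ ℤ` the multiset `{|a_1 − nγ_1|, …, |a_m − nγ_m|}`
equals the multiset `{b_1, …, b_m}`. -/
def SB {m : ℕ} (a b : Fin m → ℚ) (γ : Fin m → ℚ) : Prop :=
  ∃ n : ℤ, (Finset.univ.val.map fun i => |a i - (n : ℚ) * γ i|) = Finset.univ.val.map b

/-- The positive roots of `B_m`: the `ε_s` and the `ε_i ± ε_j`, `i < j`. -/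
def posRootsB (m : ℕ) : Set (Fin m → ℚ) :=
  {γ | (∃ s, γ = epsB m s) ∨
    ∃ i j : Fin m, i < j ∧ (γ = epsB m i - epsB m j ∨ γ = epsB m i + epsB m j)}

/-- The type `B` setting: `a_1 > ⋯ > a_m > 0` and `b_1 > ⋯ > b_m > 0`, all `2a_i`
and `2b_i` are integers, and all differences `a_i − b_j` are integers. -/
structure TypeBData (m : ℕ) (a b : Fin m → ℚ) : Prop where
  ha : StrictAnti a
  hapos : ∀ i, 0 < a i
  hb : StrictAnti b
  hbpos : ∀ i, 0 < b i
  haint : ∀ i, ∃ k : ℤ, 2 * a i = k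
  hbint : ∀ i, ∃ k : ℤ, 2 * b i = k
  habint : ∀ i j, ∃ k : ℤ, a i - b j = k

/-- Split off the contribution of two distinct indices from a multiset of values. -/
theorem map_univ_eq_cons_cons {ι α : Type*} [Fintype ι] [DecidableEq ι] (f : ι → α)
    {p q : ι} (hpq : p ≠ q) :
    (Finset.univ.val.map f) =
      f p ::ₘ f q ::ₘ ((Finset.univ.erase p).erase q).val.map f := by
  have hq : q ∈ (Finset.univ : Finset ι).erase p := by simp [hpq.symm]
  rw [← Multiset.map_cons f q, Finset.erase_val (Finset.univ.erase p),
    Multiset.cons_erase (show q ∈ (Finset.univ.erase p).val from hq), ← Multiset.map_cons f p, Finset.erase_val,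
    Multiset.cons_erase (show p ∈ Finset.univ.val from Finset.mem_univ p)]

/-- For an injective `a`, the multiset of values is the common part with `T` plus the rest. -/
theorem map_univ_eq_inter_add_sdiff {ι α : Type*} [Fintype ι] [DecidableEq α] {a : ι → α}
    (ha : Function.Injective a) (T : Finset α) :
    Finset.univ.val.map a =
      (Finset.image a Finset.univ ∩ T).val + (Finset.image a Finset.univ \ T).val := by
  rw [← Finset.image_val_of_injOn ha.injOn,
    ← Finset.disjUnion_val _ _ (Finset.disjoint_sdiff_inter _ T).symm, Finset.disjUnion_eq_union,
    Finset.union_comm, Finset.sdiff_union_inter]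

/-- If the value sets of `a` and `b` differ exactly by `{a p, a q}` and `{b c, b d}`, then changing
`a` at `p` and `q` produces the values of `b` iff the new values are `b c` and `b d`. -/
theorem map_univ_eq_iff_of_sdiff {ι α : Type*} [Fintype ι] [DecidableEq α]
    {a b f : ι → α} (ha : Function.Injective a) (hb : Function.Injective b)
    {p q c d : ι} (hpq : p ≠ q) (hcd : b c ≠ b d)
    (hD : Finset.image a Finset.univ \ Finset.image b Finset.univ = {a p, a q})
    (hD' : Finset.image b Finset.univ \ Finset.image a Finset.univ = {b c, b d})
    (hf : ∀ i, i ≠ p → i ≠ q → f i = a i) :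
    Finset.univ.val.map f = Finset.univ.val.map b ↔
      (f p = b c ∧ f q = b d) ∨ (f p = b d ∧ f q = b c) := by
  classical
  have hA := map_univ_eq_inter_add_sdiff ha (Finset.image b Finset.univ)
  have hB := map_univ_eq_inter_add_sdiff hb (Finset.image a Finset.univ)
  rw [hD, map_univ_eq_cons_cons a hpq] at hA
  rw [hD', Finset.inter_comm] at hB
  have hrest : ((Finset.univ.erase p).erase q).val.map f =
      ((Finset.univ.erase p).erase q).val.map a := by
    refine Multiset.map_congr rfl fun i hi => ?_
    have hi' : i ∈ (Finset.univ.erase p).erase q := hi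
    simp only [Finset.mem_erase, Finset.mem_univ, and_true] at hi'
    exact hf i hi'.2 hi'.1
  have hpq' : ({a p, a q} : Finset α).val = a p ::ₘ a q ::ₘ 0 :=
    Finset.insert_val_of_notMem (by simpa using ha.ne hpq)
  have hcd' : ({b c, b d} : Finset α).val = b c ::ₘ b d ::ₘ 0 :=
    Finset.insert_val_of_notMem (by simpa using hcd)
  rw [hpq', Multiset.add_cons, Multiset.add_cons, add_zero, Multiset.cons_inj_right,
    Multiset.cons_inj_right] at hA
  rw [map_univ_eq_cons_cons f hpq, hrest, hA, hB, hcd', Multiset.add_cons, Multiset.add_cons,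
    add_zero]
  constructor
  · intro h
    have h' : (f p ::ₘ f q ::ₘ 0 : Multiset α) = b c ::ₘ b d ::ₘ 0 := by
      refine add_left_cancel (a := (Finset.image a Finset.univ ∩ Finset.image b Finset.univ).val) ?_
      simpa only [Multiset.add_cons, add_zero] using h
    rcases Multiset.cons_eq_cons.1 h' with ⟨h1, h2⟩ | ⟨-, cs, h2, h3⟩
    · exact Or.inl ⟨h1, Multiset.singleton_inj.1 h2⟩
    · exact Or.inr ⟨((Multiset.singleton_eq_cons_iff _).1 h3).1.symm,
        ((Multiset.singleton_eq_cons_iff _).1 h2).1⟩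
  · rintro (⟨h1, h2⟩ | ⟨h1, h2⟩)
    · rw [h1, h2]
    · rw [h1, h2, Multiset.cons_swap]

/-- An index outside the support of `γ ∈ S(a,b)` has its value `a i` among the values of `b`. -/
theorem SB.mem_image_of_apply_eq_zero {m : ℕ} {a b γ : Fin m → ℚ} (hpos : ∀ i, 0 < a i)
    (h : SB a b γ) {i : Fin m} (hi : γ i = 0) : a i ∈ Finset.image b Finset.univ := by
  obtain ⟨n, hn⟩ := h
  have hmem : a i ∈ Finset.univ.val.map fun i => |a i - (n : ℚ) * γ i| :=
    Multiset.mem_map.2 ⟨i, Finset.mem_univ i, by simp [hi, abs_of_pos (hpos i)]⟩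
  rw [hn] at hmem
  simpa using hmem

theorem SB_iff_of_sdiff {m : ℕ} {a b γ : Fin m → ℚ} (h : TypeBData m a b)
    {p q c d : Fin m} (hpq : p ≠ q) (hcd : b c ≠ b d)
    (hD : Finset.image a Finset.univ \ Finset.image b Finset.univ = {a p, a q})
    (hD' : Finset.image b Finset.univ \ Finset.image a Finset.univ = {b c, b d})
    (hγ : ∀ i, i ≠ p → i ≠ q → γ i = 0) :
    SB a b γ ↔ ∃ n : ℤ, (|a p - n * γ p| = b c ∧ |a q - n * γ q| = b d) ∨
      (|a p - n * γ p| = b d ∧ |a q - n * γ q| = b c) :=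
  exists_congr fun n => map_univ_eq_iff_of_sdiff h.ha.injective h.hb.injective hpq hcd hD hD'
    fun i hp hq => by simp [hγ i hp hq, abs_of_pos (h.hapos i)]

theorem statement12 (m : ℕ) (hm : 2 ≤ m) (a b : Fin m → ℚ) (h : TypeBData m a b)
    (p q c d : Fin m) (hpq : p < q) (hdc : b d < b c)
    (hD : Finset.image a Finset.univ \ Finset.image b Finset.univ = {a p, a q})
    (hD' : Finset.image b Finset.univ \ Finset.image a Finset.univ = {b c, b d}) :
    (SB a b (epsB m p - epsB m q) ↔ (a p + a q = b c + b d ∨ a p + a q = b c - b d)) ∧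
    (SB a b (epsB m p + epsB m q) ↔ (a p - a q = b c + b d ∨ a p - a q = b c - b d)) ∧
    (∀ γ ∈ posRootsB m, SB a b γ →
      γ = epsB m p - epsB m q ∨ γ = epsB m p + epsB m q) ∧
    {γ ∈ posRootsB m | SB a b γ}.Subsingleton := by
  have hpq' := hpq.ne
  have hap := h.hapos p
  have haq := h.hapos q
  have hbc := h.hbpos c
  have hbd := h.hbpos d
  have hlt := h.ha hpq
  obtain ⟨k, hk⟩ := h.habint p c
  have hnot : ∀ x ∈ ({a p, a q} : Finset ℚ), x ∉ Finset.image b Finset.univ := fun x hx =>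
    (Finset.mem_sdiff.1 (hD ▸ hx)).2
  have hp := hnot (a p) (by simp)
  have hq := hnot (a q) (by simp)
  have hsub : SB a b (epsB m p - epsB m q) ↔
      (a p + a q = b c + b d ∨ a p + a q = b c - b d) := by
    rw [SB_iff_of_sdiff h hpq' hdc.ne' hD hD'
      (fun i hip hiq => by simp [epsB, hip, hiq])]
    simp only [epsB, Pi.sub_apply, Pi.single_eq_same, Pi.single_eq_of_ne hpq',
      Pi.single_eq_of_ne hpq'.symm, abs_eq hbc.le, abs_eq hbd.le]
    constructor
    · rintro ⟨n, ⟨h1 | h1, h2 | h2⟩ | ⟨h1 | h1, h2 | h2⟩⟩ <;>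
        first | (left; linarith) | (right; linarith)
    · rintro (h1 | h1)
      · exact ⟨k, Or.inl ⟨Or.inl (by linarith), Or.inl (by linarith)⟩⟩
      · exact ⟨k, Or.inl ⟨Or.inl (by linarith), Or.inr (by linarith)⟩⟩
  have hadd : SB a b (epsB m p + epsB m q) ↔
      (a p - a q = b c + b d ∨ a p - a q = b c - b d) := by
    rw [SB_iff_of_sdiff h hpq' hdc.ne' hD hD'
      (fun i hip hiq => by simp [epsB, hip, hiq])]
    simp only [epsB, Pi.add_apply, Pi.single_eq_same, Pi.single_eq_of_ne hpq',
      Pi.single_eq_of_ne hpq'.symm, abs_eq hbc.le, abs_eq hbd.le]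
    constructor
    · rintro ⟨n, ⟨h1 | h1, h2 | h2⟩ | ⟨h1 | h1, h2 | h2⟩⟩ <;>
        first | (left; linarith) | (right; linarith)
    · rintro (h1 | h1)
      · exact ⟨k, Or.inl ⟨Or.inl (by linarith), Or.inr (by linarith)⟩⟩
      · exact ⟨k, Or.inl ⟨Or.inl (by linarith), Or.inl (by linarith)⟩⟩
  have honly : ∀ γ ∈ posRootsB m, SB a b γ →
      γ = epsB m p - epsB m q ∨ γ = epsB m p + epsB m q := by
    intro γ hγ hS
    have hγp : γ p ≠ 0 := fun h0 => hp (hS.mem_image_of_apply_eq_zero h.hapos h0)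
    have hγq : γ q ≠ 0 := fun h0 => hq (hS.mem_image_of_apply_eq_zero h.hapos h0)
    rcases hγ with ⟨s, rfl⟩ | ⟨i, j, hij, hγ⟩
    · have hps : p = s := by
        by_contra hne
        exact hγp (by simp [epsB, hne])
      have hqs : q = s := by
        by_contra hne
        exact hγq (by simp [epsB, hne])
      exact absurd (hps.trans hqs.symm) hpq'
    · have hsupp : ∀ r, γ r ≠ 0 → r = i ∨ r = j := by
        intro r hr
        by_contra! hne
        rcases hγ with rfl | rfl <;> exact hr (by simp [epsB, hne.1, hne.2])
      have hi : i = p ∧ j = q := by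
        rcases hsupp p hγp with h1 | h1 <;> rcases hsupp q hγq with h2 | h2 <;> omega
      rwa [hi.1, hi.2] at hγ
  have hnb : ¬(SB a b (epsB m p - epsB m q) ∧ SB a b (epsB m p + epsB m q)) := by
    rw [hsub, hadd]
    rintro ⟨h1 | h1, h2 | h2⟩
    · linarith
    · exact hp (Finset.mem_image.2 ⟨c, Finset.mem_univ c, by linarith⟩)
    · linarith
    · linarith
  refine ⟨hsub, hadd, honly, ?_⟩
  rintro γ ⟨hγ, hS⟩ δ ⟨hδ, hT⟩
  rcases honly γ hγ hS with rfl | rfl <;> rcases honly δ hδ hT with rfl | rfl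
  · rfl
  · exact absurd ⟨hS, hT⟩ hnb
  · exact absurd ⟨hT, hS⟩ hnb
  · rfl
end

section
/- (Type B, singleton difference sets.) In the type B setting, suppose |D_ab| = 1, say D_ab = {a_s} and D_ba = {b_t}. Then: (i) the positive root ε_s belongs to S(a,b) (with n = a_s − b_t and n = a_s + b_t both admissible); (ii) for u ≠ s, the positive root ±(ε_s − ε_u) belongs to S(a,b) if and only if a_s − b_t = −2a_u; (iii) for u ≠ s, the positive root ε_s + ε_u belongs to S(a,b) if and only if a_s − b_t = 2a_u or a_s + b_t = 2a_u; (iv) no positive root not involving the index s belongs to S(a,b). Consequently 1 ≤ |S(a,b)| ≤ 3, and if m = 2 then |S(a,b)| ≤ 2. -/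
theorem map_eq_map_update {ι α : Type*} [Fintype ι] [DecidableEq ι] [DecidableEq α]
    {a b : ι → α} (ha : a.Injective) (hb : b.Injective) {s t : ι}
    (hD : Finset.image a Finset.univ \ Finset.image b Finset.univ = {a s})
    (hD' : Finset.image b Finset.univ \ Finset.image a Finset.univ = {b t}) :
    Finset.univ.val.map b = Finset.univ.val.map (Function.update a s (b t)) := by
  have h1 : ∀ x, (x ∈ Set.range a ∧ x ∉ Set.range b) ↔ x = a s := fun x => by
    simpa using Finset.ext_iff.1 hD x
  have h2 : ∀ x, (x ∈ Set.range b ∧ x ∉ Set.range a) ↔ x = b t := fun x => by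
    simpa using Finset.ext_iff.1 hD' x
  have hbt := (h2 (b t)).2 rfl
  have hu : (Function.update a s (b t)).Injective :=
    fun i j hij => by
      by_cases hi : i = s <;> by_cases hj : j = s
      · rw [hi, hj]
      · rw [hi, Function.update_self, Function.update_of_ne hj] at hij
        exact absurd ⟨j, hij.symm⟩ hbt.2
      · rw [hj, Function.update_self, Function.update_of_ne hi] at hij
        exact absurd ⟨i, hij⟩ hbt.2
      · rw [Function.update_of_ne hi, Function.update_of_ne hj] at hij
        exact ha hij
  refine (Multiset.Nodup.ext (Finset.univ.nodup.map hb) (Finset.univ.nodup.map hu)).2 fun x => ?_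
  simp only [Multiset.mem_map, Finset.mem_val, Finset.mem_univ, true_and]
  constructor
  · rintro ⟨i, rfl⟩
    by_cases hi : b i ∈ Set.range a
    · obtain ⟨j, hj⟩ := hi
      have hjs : j ≠ s := by
        rintro rfl
        exact ((h1 (a j)).2 rfl).2 ⟨i, hj.symm⟩
      exact ⟨j, by rw [Function.update_of_ne hjs, hj]⟩
    · exact ⟨s, by rw [Function.update_self, (h2 (b i)).1 ⟨⟨i, rfl⟩, hi⟩]⟩
  · rintro ⟨j, rfl⟩
    by_cases hjs : j = s
    · subst hjs
      exact ⟨t, by simp⟩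
    · rw [Function.update_of_ne hjs]
      by_contra hj
      exact hjs (ha ((h1 (a j)).1 ⟨⟨j, rfl⟩, hj⟩))

theorem map_univ_eq_iff_of_eqOn_ne {ι α : Type*} [Fintype ι] [DecidableEq ι]
    {f g : ι → α} {s : ι} (hfg : ∀ i, i ≠ s → f i = g i) :
    Finset.univ.val.map f = Finset.univ.val.map g ↔ f s = g s := by
  have hs : (Finset.univ : Finset ι).val = s ::ₘ (Finset.univ.erase s).val := by
    rw [Finset.erase_val, Multiset.cons_erase (Finset.mem_univ s)]
  have hr : (Finset.univ.erase s).val.map f = (Finset.univ.erase s).val.map g :=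
    Multiset.map_congr rfl fun i hi => hfg i (Finset.ne_of_mem_erase hi)
  rw [hs, Multiset.map_cons, Multiset.map_cons, hr, Multiset.cons_inj_left]

theorem map_univ_eq_iff_of_eqOn_ne_ne {ι α : Type*} [Fintype ι] [DecidableEq ι]
    {f g : ι → α} {s u : ι} (hus : u ≠ s) (hfg : ∀ i, i ≠ s → i ≠ u → f i = g i) :
    Finset.univ.val.map f = Finset.univ.val.map g ↔
      (f s = g s ∧ f u = g u) ∨ (f s = g u ∧ f u = g s) := by
  have hs : (Finset.univ : Finset ι).val =
      {s, u} + ((Finset.univ.erase s).erase u).val := by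
    rw [Finset.erase_val, Multiset.insert_eq_cons, Multiset.cons_add, Multiset.singleton_add,
      Multiset.cons_erase (Finset.mem_erase.2 ⟨hus, Finset.mem_univ u⟩), Finset.erase_val,
      Multiset.cons_erase (Finset.mem_univ s)]
  have hr : ((Finset.univ.erase s).erase u).val.map f =
      ((Finset.univ.erase s).erase u).val.map g :=
    Multiset.map_congr rfl fun i hi => by
      have hi' := Finset.mem_erase.1 hi
      exact hfg i (Finset.ne_of_mem_erase hi'.2) hi'.1
  rw [hs, Multiset.map_add, Multiset.map_add, hr, add_left_inj]
  simp only [Multiset.insert_eq_cons, Multiset.map_cons, Multiset.map_singleton]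
  constructor
  · intro h
    rcases Multiset.cons_eq_cons.1 h with ⟨h1, h2⟩ | ⟨-, cs, h1, h2⟩
    · exact Or.inl ⟨h1, Multiset.singleton_inj.1 h2⟩
    · have hu : g s ∈ ({f u} : Multiset α) := h1 ▸ Multiset.mem_cons_self _ _
      have hs : f s ∈ ({g u} : Multiset α) := h2 ▸ Multiset.mem_cons_self _ _
      exact Or.inr ⟨Multiset.mem_singleton.1 hs, (Multiset.mem_singleton.1 hu).symm⟩
  · rintro (⟨h1, h2⟩ | ⟨h1, h2⟩)
    · rw [h1, h2]
    · rw [h1, h2]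
      exact Multiset.pair_comm _ _

theorem SB_neg {m : ℕ} {a b γ : Fin m → ℚ} (h : SB a b γ) : SB a b (-γ) := by
  obtain ⟨n, hn⟩ := h
  exact ⟨-n, by simpa using hn⟩

/-- The positive one of the two roots `ε_s - ε_u` and `ε_u - ε_s`. -/
def posDiffB (m : ℕ) (s u : Fin m) : Fin m → ℚ :=
  if s < u then epsB m s - epsB m u else epsB m u - epsB m s

theorem SB_posDiffB {m : ℕ} {a b : Fin m → ℚ} {s u : Fin m} (h : SB a b (posDiffB m s u)) :
    SB a b (epsB m s - epsB m u) := by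
  unfold posDiffB at h
  split_ifs at h
  · exact h
  · simpa using SB_neg h

theorem eq_of_mem_posRootsB {m : ℕ} {γ : Fin m → ℚ} (hγ : γ ∈ posRootsB m) {s : Fin m}
    (hs : γ s ≠ 0) :
    γ = epsB m s ∨ ∃ u, u ≠ s ∧ (γ = posDiffB m s u ∨ γ = epsB m s + epsB m u) := by
  have h0 : ∀ i, i ≠ s → epsB m i s = 0 := fun i hi => by simp [epsB, hi.symm]
  rcases hγ with ⟨i, rfl⟩ | ⟨i, j, hij, hγ⟩
  · by_cases hi : i = s
    · exact Or.inl (by rw [hi])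
    · exact absurd (h0 i hi) hs
  · right
    by_cases hi : i = s
    · subst hi
      refine ⟨j, hij.ne', ?_⟩
      simpa [posDiffB, hij] using hγ
    · by_cases hj : j = s
      · subst hj
        refine ⟨i, hi, ?_⟩
        simpa [posDiffB, hij.not_gt, add_comm (epsB m j)] using hγ
      · exact absurd (by rcases hγ with rfl | rfl <;> simp [h0 i hi, h0 j hj]) hs

theorem statement13 (m : ℕ) (hm : 2 ≤ m) (a b : Fin m → ℚ) (h : TypeBData m a b)
    (s t : Fin m)
    (hD : Finset.image a Finset.univ \ Finset.image b Finset.univ = {a s})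
    (hD' : Finset.image b Finset.univ \ Finset.image a Finset.univ = {b t}) :
    SB a b (epsB m s) ∧
    (∀ n : ℤ, ((n : ℚ) = a s - b t ∨ (n : ℚ) = a s + b t) →
      (Finset.univ.val.map fun i => |a i - (n : ℚ) * epsB m s i|) =
        Finset.univ.val.map b) ∧
    (∀ u, u ≠ s → (SB a b (epsB m s - epsB m u) ↔ a s - b t = -(2 * a u))) ∧
    (∀ u, u ≠ s →
      (SB a b (epsB m s + epsB m u) ↔ (a s - b t = 2 * a u ∨ a s + b t = 2 * a u))) ∧
    (∀ γ ∈ posRootsB m, SB a b γ → γ s ≠ 0) ∧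
    1 ≤ {γ ∈ posRootsB m | SB a b γ}.ncard ∧
    {γ ∈ posRootsB m | SB a b γ}.ncard ≤ 3 ∧
    (m = 2 → {γ ∈ posRootsB m | SB a b γ}.ncard ≤ 2) := by
  have hmap := map_eq_map_update h.ha.injective h.hb.injective hD hD'
  have has : a s ∉ Set.range b := by
    have := (Finset.ext_iff.1 hD (a s)).2 (Finset.mem_singleton_self _)
    simpa using (Finset.mem_sdiff.1 this).2
  have hne : a s ≠ b t := fun e => has ⟨t, e.symm⟩
  have hps := h.hapos s
  have hpt := h.hbpos t
  have hself : ∀ i, epsB m i i = 1 := fun i => by simp [epsB]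
  have h0 : ∀ i j, i ≠ j → epsB m i j = 0 := fun i j hij => by simp [epsB, hij.symm]
  have hsingle : ∀ n : ℤ, ((n : ℚ) = a s - b t ∨ (n : ℚ) = a s + b t) →
      (Finset.univ.val.map fun i => |a i - (n : ℚ) * epsB m s i|) =
        Finset.univ.val.map b := by
    intro n hn
    rw [hmap, map_univ_eq_iff_of_eqOn_ne (s := s)]
    · rw [hself, Function.update_self]
      rcases hn with hn | hn <;> simp [hn, abs_of_pos hpt]
    · intro i hi
      simp [h0 s i hi.symm, hi, abs_of_pos (h.hapos i)]
  have hSBs : SB a b (epsB m s) := by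
    obtain ⟨n, hn⟩ := h.habint s t
    exact ⟨n, hsingle n (Or.inl hn.symm)⟩
  have hsub : ∀ u, u ≠ s → (SB a b (epsB m s - epsB m u) ↔ a s - b t = -(2 * a u)) := by
    intro u hu
    have hpu := h.hapos u
    have key : ∀ n : ℤ, _ := fun n : ℤ => map_univ_eq_iff_of_eqOn_ne_ne
      (f := fun i => |a i - (n : ℚ) * (epsB m s - epsB m u) i|)
      (g := Function.update a s (b t)) hu (fun i his hiu => by
        simp [h0 s i his.symm, h0 u i hiu.symm, his, abs_of_pos (h.hapos i)])
    simp only [Pi.sub_apply, hself, h0 s u hu.symm, h0 u s hu, Function.update_self,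
      Function.update_of_ne hu] at key
    simp only [SB, hmap, Pi.sub_apply, key]
    constructor
    · rintro ⟨n, ⟨h1, h2⟩ | ⟨h1, h2⟩⟩ <;>
      rcases (abs_eq (by positivity)).1 h1 with h1 | h1 <;>
      rcases (abs_eq (by positivity)).1 h2 with h2 | h2 <;>
      first
        | linarith
        | exact absurd (by linarith) hne
    · intro e
      obtain ⟨k, hk⟩ := h.haint u
      refine ⟨-k, Or.inl ⟨?_, ?_⟩⟩
      · rw [abs_eq hpt.le]; push_cast; left; linarith
      · rw [abs_eq hpu.le]; push_cast; right; linarith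
  have hadd : ∀ u, u ≠ s →
      (SB a b (epsB m s + epsB m u) ↔ (a s - b t = 2 * a u ∨ a s + b t = 2 * a u)) := by
    intro u hu
    have hpu := h.hapos u
    have key : ∀ n : ℤ, _ := fun n : ℤ => map_univ_eq_iff_of_eqOn_ne_ne
      (f := fun i => |a i - (n : ℚ) * (epsB m s + epsB m u) i|)
      (g := Function.update a s (b t)) hu (fun i his hiu => by
        simp [h0 s i his.symm, h0 u i hiu.symm, his, abs_of_pos (h.hapos i)])
    simp only [Pi.add_apply, hself, h0 s u hu.symm, h0 u s hu, Function.update_self,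
      Function.update_of_ne hu] at key
    simp only [SB, hmap, Pi.add_apply, key]
    constructor
    · rintro ⟨n, ⟨h1, h2⟩ | ⟨h1, h2⟩⟩ <;>
      rcases (abs_eq (by positivity)).1 h1 with h1 | h1 <;>
      rcases (abs_eq (by positivity)).1 h2 with h2 | h2 <;>
      first
        | exact absurd (by linarith) hne
        | (left; linarith)
        | (right; linarith)
    · intro e
      obtain ⟨k, hk⟩ := h.haint u
      refine ⟨k, Or.inl ⟨?_, ?_⟩⟩
      · rw [abs_eq hpt.le]
        rcases e with e | e
        · left; linarith
        · right; linarith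
      · rw [abs_eq hpu.le]; right; linarith
  have hsupp : ∀ γ ∈ posRootsB m, SB a b γ → γ s ≠ 0 := by
    rintro γ - ⟨n, hn⟩ h0s
    have hmem : a s ∈ Finset.univ.val.map b := by
      rw [← hn]
      exact Multiset.mem_map.2 ⟨s, Finset.mem_univ s, by simp [h0s, abs_of_pos hps]⟩
    obtain ⟨i, -, hi⟩ := Multiset.mem_map.1 hmem
    exact has ⟨i, hi⟩
  let P : Set (Fin m → ℚ) := {γ | ∃ u, u ≠ s ∧ ((a s - b t = -(2 * a u) ∧ γ = posDiffB m s u) ∨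
    (a s - b t = 2 * a u ∧ γ = epsB m s + epsB m u))}
  let Q : Set (Fin m → ℚ) := {γ | ∃ u, u ≠ s ∧ a s + b t = 2 * a u ∧ γ = epsB m s + epsB m u}
  have hP : P.Subsingleton := by
    rintro γ ⟨u, -, hu⟩ δ ⟨v, -, hv⟩
    have hpu := h.hapos u
    have hpv := h.hapos v
    rcases hu with ⟨hu, rfl⟩ | ⟨hu, rfl⟩ <;> rcases hv with ⟨hv, rfl⟩ | ⟨hv, rfl⟩
    · rw [h.ha.injective (show a u = a v by linarith)]
    · linarith
    · linarith
    · rw [h.ha.injective (show a u = a v by linarith)]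
  have hQ : Q.Subsingleton := by
    rintro γ ⟨u, -, hu, rfl⟩ δ ⟨v, -, hv, rfl⟩
    rw [h.ha.injective (show a u = a v by linarith)]
  have hS : {γ ∈ posRootsB m | SB a b γ} ⊆ {epsB m s} ∪ (P ∪ Q) := by
    rintro γ ⟨hγ, hSB⟩
    rcases eq_of_mem_posRootsB hγ (hsupp γ hγ hSB) with rfl | ⟨u, hu, rfl | rfl⟩
    · exact Or.inl rfl
    · exact Or.inr (Or.inl ⟨u, hu, Or.inl ⟨(hsub u hu).1 (SB_posDiffB hSB), rfl⟩⟩)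
    · rcases (hadd u hu).1 hSB with e | e
      · exact Or.inr (Or.inl ⟨u, hu, Or.inr ⟨e, rfl⟩⟩)
      · exact Or.inr (Or.inr ⟨u, hu, e, rfl⟩)
  have hfin : ({epsB m s} ∪ (P ∪ Q)).Finite :=
    (Set.finite_singleton _).union (hP.finite.union hQ.finite)
  have hcP : P.ncard ≤ 1 := (Set.ncard_le_one hP.finite).2 fun _ hx _ hy => hP hx hy
  have hcQ : Q.ncard ≤ 1 := (Set.ncard_le_one hQ.finite).2 fun _ hx _ hy => hQ hx hy
  have hcard : {γ ∈ posRootsB m | SB a b γ}.ncard ≤ 1 + (P.ncard + Q.ncard) := by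
    refine (Set.ncard_le_ncard hS hfin).trans ((Set.ncard_union_le _ _).trans ?_)
    rw [Set.ncard_singleton]
    exact Nat.add_le_add_left (Set.ncard_union_le _ _) 1
  refine ⟨hSBs, hsingle, hsub, hadd, hsupp, ?_, by omega, ?_⟩
  · exact (Set.ncard_pos (hfin.subset hS)).2 ⟨epsB m s, Or.inl ⟨s, rfl⟩, hSBs⟩
  · rintro rfl
    have hPQ : P = ∅ ∨ Q = ∅ := by
      by_contra! hcon
      obtain ⟨⟨γ, u, hu, hu'⟩, ⟨δ, v, hv, hv', -⟩⟩ := hcon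
      obtain rfl : u = v := by omega
      rcases hu' with ⟨e, -⟩ | ⟨e, -⟩ <;> linarith
    rcases hPQ with e | e
    · rw [e, Set.ncard_empty] at hcard
      omega
    · rw [e, Set.ncard_empty] at hcard
      omega
end

section
/- (Type B, emptiness.) In the type B setting, if |D_ab| ≥ 3 then S(a,b) = ∅; that is, S(a,b) is empty unless |D_ab| = |D_ba| ∈ {1, 2}. -/
/-- A positive root of `B_m` is supported on at most two coordinates. -/
lemma exists_pair_of_mem_posRootsB {m : ℕ} {γ : Fin m → ℚ} (hγ : γ ∈ posRootsB m) :
    ∃ i j : Fin m, ∀ k, k ≠ i → k ≠ j → γ k = 0 := by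
  rcases hγ with ⟨s, rfl⟩ | ⟨i, j, -, rfl | rfl⟩
  · exact ⟨s, s, fun k hk _ => by simp [epsB, hk]⟩
  · exact ⟨i, j, fun k hi hj => by simp [epsB, hi, hj]⟩
  · exact ⟨i, j, fun k hi hj => by simp [epsB, hi, hj]⟩

/-- If `γ ∈ S(a,b)` vanishes at `k` and `a k` is nonnegative, then `a k` is a value of `b`. -/
lemma SB.exists_eq {m : ℕ} {a b γ : Fin m → ℚ} (hS : SB a b γ) {k : Fin m} (hk : γ k = 0)
    (ha : 0 ≤ a k) : ∃ l, b l = a k := by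
  obtain ⟨n, hn⟩ := hS
  have hmem : |a k - (n : ℚ) * γ k| ∈ Finset.univ.val.map b :=
    hn ▸ Multiset.mem_map_of_mem _ (Finset.mem_univ_val k)
  simpa [hk, abs_of_nonneg ha] using hmem

theorem statement14 (m : ℕ) (hm : 2 ≤ m) (a b : Fin m → ℚ) (h : TypeBData m a b)
    (hD : 3 ≤ (Finset.image a Finset.univ \ Finset.image b Finset.univ).card) :
    {γ ∈ posRootsB m | SB a b γ} = ∅ := by
  refine Set.eq_empty_of_forall_notMem fun γ ⟨hγ, hS⟩ => ?_
  obtain ⟨i, j, hij⟩ := exists_pair_of_mem_posRootsB hγ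
  have hsub : Finset.image a Finset.univ \ Finset.image b Finset.univ ⊆ {a i, a j} := by
    intro x hx
    simp only [Finset.mem_sdiff, Finset.mem_image, Finset.mem_univ, true_and] at hx
    obtain ⟨⟨k, rfl⟩, hb⟩ := hx
    by_contra hk
    simp only [Finset.mem_insert, Finset.mem_singleton, not_or] at hk
    exact hb (hS.exists_eq (hij k (fun e => hk.1 (e ▸ rfl)) fun e => hk.2 (e ▸ rfl))
      (h.hapos k).le)
  have := (Finset.card_le_card hsub).trans Finset.card_le_two
  omega
end

section
/- (Type C, parity criterion for the long root.) In the type C setting, suppose |D_ab| = 1, say D_ab = {a_s} and D_ba = {b_t}. Then the positive long root 2ε_s belongs to S(a,b) if and only if a_s ≡ b_t (mod 2) (equivalently, a_s − b_t is even, equivalently a_s + b_t is even); and no long root 2ε_u with u ≠ s belongs to S(a,b). -/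
/-- the standard basis vector `ε_s` of `ℤ^m`. -/
def epsC (m : ℕ) (s : Fin m) : Fin m → ℤ := Pi.single s 1

/-- `γ ∈ S(a,b)`: for some `n ∈ ℤ` the multiset `{|a_1 − nγ_1|, …, |a_m − nγ_m|}`
equals the multiset `{b_1, …, b_m}`. -/
def SC {m : ℕ} (a b : Fin m → ℤ) (γ : Fin m → ℤ) : Prop :=
  ∃ n : ℤ, (Finset.univ.val.map fun i => |a i - n * γ i|) = Finset.univ.val.map b

/-- The positive roots of `C_m`: the `2ε_s` and the `ε_i ± ε_j`, `i < j`. -/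
def posRootsC (m : ℕ) : Set (Fin m → ℤ) :=
  {γ | (∃ s, γ = 2 • epsC m s) ∨
    ∃ i j : Fin m, i < j ∧ (γ = epsC m i - epsC m j ∨ γ = epsC m i + epsC m j)}

theorem abs_sub_mul_two_smul_epsC_of_ne {m : ℕ} {a : Fin m → ℤ} (hapos : ∀ i, 0 < a i) (n : ℤ)
    {i s : Fin m} (h : i ≠ s) : |a i - n * (2 • epsC m s) i| = a i := by
  simp [epsC, h, abs_of_pos (hapos i)]

theorem abs_sub_mul_two_smul_epsC_self {m : ℕ} (a : Fin m → ℤ) (n : ℤ) (s : Fin m) :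
    |a s - n * (2 • epsC m s) s| = |a s - n * 2| := by
  simp [epsC]

theorem mem_iff_of_sdiff_eq_singleton {α : Type*} [DecidableEq α] {A B : Finset α} {x y : α}
    (hAB : A \ B = {x}) (hBA : B \ A = {y}) (z : α) : z ∈ B ↔ z = y ∨ z ∈ A ∧ z ≠ x := by
  have h₁ := Finset.ext_iff.mp hAB z
  have h₂ := Finset.ext_iff.mp hBA z
  simp only [Finset.mem_sdiff, Finset.mem_singleton] at h₁ h₂
  tauto

theorem statement16 (m : ℕ) (hm : 2 ≤ m) (a b : Fin m → ℤ)
    (ha : StrictAnti a) (hapos : ∀ i, 0 < a i)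
    (hb : StrictAnti b) (hbpos : ∀ i, 0 < b i)
    (s t : Fin m)
    (hD : Finset.image a Finset.univ \ Finset.image b Finset.univ = {a s})
    (hD' : Finset.image b Finset.univ \ Finset.image a Finset.univ = {b t}) :
    (SC a b (2 • epsC m s) ↔ (2 : ℤ) ∣ (a s - b t)) ∧
    ∀ u, u ≠ s → ¬ SC a b (2 • epsC m u) := by
  have has := Finset.mem_sdiff.mp (hD ▸ Finset.mem_singleton_self (a s))
  have hbt := Finset.mem_sdiff.mp (hD' ▸ Finset.mem_singleton_self (b t))
  refine ⟨⟨?_, ?_⟩, ?_⟩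
  · rintro ⟨n, hn⟩
    have hmem : b t ∈ Finset.univ.val.map fun i => |a i - n * (2 • epsC m s) i| :=
      hn ▸ Multiset.mem_map_of_mem b (Finset.mem_univ_val t)
    obtain ⟨i, -, hi⟩ := Multiset.mem_map.mp hmem
    by_cases his : i = s
    · subst his
      rw [abs_sub_mul_two_smul_epsC_self] at hi
      rcases abs_choice (a i - n * 2) with h | h <;> omega
    · rw [abs_sub_mul_two_smul_epsC_of_ne hapos n his] at hi
      exact absurd (hi ▸ Finset.mem_image_of_mem a (Finset.mem_univ i)) hbt.2
  · rintro ⟨n, hn⟩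
    have hf : (fun i => |a i - n * (2 • epsC m s) i|) = Function.update a s (b t) := by
      funext i
      by_cases his : i = s
      · subst his
        rw [abs_sub_mul_two_smul_epsC_self, Function.update_self,
          show a i - n * 2 = b t by omega, abs_of_pos (hbpos t)]
      · rw [abs_sub_mul_two_smul_epsC_of_ne hapos n his, Function.update_of_ne his]
    have hne : ∀ i, a i ≠ b t := fun i h =>
      hbt.2 (h ▸ Finset.mem_image_of_mem a (Finset.mem_univ i))
    have hinj : Function.Injective (Function.update a s (b t)) := by
      intro i j hij
      by_cases hi : i = s <;> by_cases hj : j = s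
      · rw [hi, hj]
      · subst hi
        rw [Function.update_self, Function.update_of_ne hj] at hij
        exact absurd hij.symm (hne j)
      · subst hj
        rw [Function.update_self, Function.update_of_ne hi] at hij
        exact absurd hij (hne i)
      · rw [Function.update_of_ne hi, Function.update_of_ne hj] at hij
        exact ha.injective hij
    refine ⟨n, ?_⟩
    rw [hf]
    refine (Multiset.Nodup.ext (Finset.univ.nodup.map hinj)
      (Finset.univ.nodup.map hb.injective)).mpr fun x => ?_
    have hx := mem_iff_of_sdiff_eq_singleton hD hD' x
    simp only [Finset.mem_image, Finset.mem_univ, true_and] at hx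
    simp only [Multiset.mem_map, Finset.mem_val, Finset.mem_univ, true_and]
    rw [hx]
    constructor
    · rintro ⟨i, rfl⟩
      by_cases his : i = s
      · exact Or.inl (by rw [his, Function.update_self])
      · rw [Function.update_of_ne his]
        exact Or.inr ⟨⟨i, rfl⟩, ha.injective.ne his⟩
    · rintro (rfl | ⟨⟨i, rfl⟩, his⟩)
      · exact ⟨s, Function.update_self ..⟩
      · exact ⟨i, Function.update_of_ne (ne_of_apply_ne a his) ..⟩
  · rintro u hu ⟨n, hn⟩
    have hmem : a s ∈ Finset.univ.val.map b :=
      hn ▸ Multiset.mem_map.mpr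
        ⟨s, Finset.mem_univ_val s, abs_sub_mul_two_smul_epsC_of_ne hapos n hu.symm⟩
    obtain ⟨j, -, hj⟩ := Multiset.mem_map.mp hmem
    exact has.2 (hj ▸ Finset.mem_image_of_mem b (Finset.mem_univ j))
end

section
/- (Type C, cardinality bounds.) In the type C setting: if |D_ab| = 2 then S(a,b) contains at most one element; if |D_ab| = 1 then S(a,b) contains at most three elements; and if |D_ab| ≥ 3 then S(a,b) is empty. In particular |S(a,b)| ≤ 3 always. -/
open Finset in
lemma pair_add_map_eq {ι : Type*} [Fintype ι] [DecidableEq ι] {i j : ι} (hij : i ≠ j)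
    {f g : ι → ℤ} (h : ∀ k, k ≠ i → k ≠ j → f k = g k) :
    g i ::ₘ g j ::ₘ univ.val.map f = f i ::ₘ f j ::ₘ univ.val.map g := by
  have huniv : (univ : Finset ι).val = i ::ₘ j ::ₘ ((univ.erase i).erase j).val := by
    rw [← insert_val_of_notMem (notMem_erase j _), insert_erase (by simp [hij.symm]),
      ← insert_val_of_notMem (notMem_erase i _), insert_erase (mem_univ i)]
  have hrest : ((univ.erase i).erase j).val.map f = ((univ.erase i).erase j).val.map g :=
    Multiset.map_congr rfl fun k hk => by
      simp only [mem_val, mem_erase] at hk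
      exact h k hk.2.1 hk.1
  simp only [huniv, Multiset.map_cons, hrest]
  simp only [← Multiset.singleton_add]
  abel

lemma cons_cons_cancel {p q r s : ℤ} {M : Multiset ℤ}
    (h : p ::ₘ q ::ₘ M = r ::ₘ s ::ₘ M) : p = r ∧ q = s ∨ p = s ∧ q = r := by
  have h' : ({p, q} : Multiset ℤ) = {r, s} := by
    apply add_right_cancel (b := M)
    simpa using h
  have hp := congrArg (p ∈ ·) h'
  have hq := congrArg (q ∈ ·) h'
  have hr := congrArg (r ∈ ·) h'
  have hs := congrArg (s ∈ ·) h'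
  simp at hp hq hr hs
  grind

section TypeC

variable {m : ℕ} {a b : Fin m → ℤ}

lemma map_eq_image_val (ha : Function.Injective a) :
    Finset.univ.val.map a = (Finset.univ.image a).val :=
  (Finset.image_val_of_injOn ha.injOn).symm

/-- A coordinate outside the support of `γ` survives in `b`. -/
lemma SC.mem_image_of_eq_zero (hapos : ∀ i, 0 < a i) {γ : Fin m → ℤ} (h : SC a b γ)
    {k : Fin m} (hk : γ k = 0) : a k ∈ Finset.univ.image b := by
  obtain ⟨n, hn⟩ := h
  have : |a k - n * γ k| ∈ Finset.univ.val.map b := hn ▸ Multiset.mem_map_of_mem _ (by simp)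
  rw [hk, mul_zero, sub_zero, abs_of_pos (hapos k)] at this
  simpa using this

lemma SC.sdiff_subset_pair (hapos : ∀ i, 0 < a i) {γ : Fin m → ℤ} (h : SC a b γ)
    {i j : Fin m} (hγ : ∀ k, k ≠ i → k ≠ j → γ k = 0) :
    Finset.univ.image a \ Finset.univ.image b ⊆ {a i, a j} := by
  intro x hx
  obtain ⟨hxa, hxb⟩ := Finset.mem_sdiff.1 hx
  obtain ⟨k, -, rfl⟩ := Finset.mem_image.1 hxa
  have : k = i ∨ k = j := by
    by_contra! hk
    exact hxb (h.mem_image_of_eq_zero hapos (hγ k hk.1 hk.2))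
  rcases this with rfl | rfl <;> simp

/-- Comparing the two multisets for a root supported on `{i, j}`. -/
lemma SC.exists_pair (hapos : ∀ i, 0 < a i) {γ : Fin m → ℤ} (h : SC a b γ)
    {i j : Fin m} (hij : i ≠ j) (hγ : ∀ k, k ≠ i → k ≠ j → γ k = 0) :
    ∃ n : ℤ, a i ::ₘ a j ::ₘ Finset.univ.val.map b =
        |a i - n * γ i| ::ₘ |a j - n * γ j| ::ₘ Finset.univ.val.map a ∧
      |a i - n * γ i| ∈ Finset.univ.image b ∧ |a j - n * γ j| ∈ Finset.univ.image b := by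
  obtain ⟨n, hn⟩ := h
  have hmem (k : Fin m) : |a k - n * γ k| ∈ Finset.univ.image b := by
    have : |a k - n * γ k| ∈ Finset.univ.val.map b := hn ▸ Multiset.mem_map_of_mem _ (by simp)
    simpa using this
  refine ⟨n, ?_, hmem i, hmem j⟩
  rw [← hn]
  exact pair_add_map_eq (f := fun k => |a k - n * γ k|) hij fun k hki hkj => by
    simp [hγ k hki hkj, abs_of_pos (hapos k)]

lemma two_epsC_apply_of_ne {s k : Fin m} (hk : k ≠ s) : (2 • epsC m s) k = 0 := by
  simp [epsC, hk]

/-- Positive roots are long roots `2ε_s` or short roots `ε_i + c ε_j` with `c = ±1`. -/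
lemma mem_posRootsC_cases {γ : Fin m → ℤ} (h : γ ∈ posRootsC m) :
    (∃ s, γ = 2 • epsC m s) ∨ ∃ i j : Fin m, i < j ∧ ∃ c : ℤ, (c = 1 ∨ c = -1) ∧
      γ = epsC m i + c • epsC m j ∧ γ i = 1 ∧ γ j = c ∧
      ∀ k, k ≠ i → k ≠ j → γ k = 0 := by
  rcases h with h | ⟨i, j, hij, rfl | rfl⟩
  · exact Or.inl h
  · refine Or.inr ⟨i, j, hij, -1, Or.inr rfl, by simp [sub_eq_add_neg], ?_, ?_, ?_⟩
    · simp [epsC, hij.ne]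
    · simp [epsC, hij.ne']
    · intro k hi hj
      simp [epsC, hi, hj]
  · refine Or.inr ⟨i, j, hij, 1, Or.inl rfl, by simp, ?_, ?_, ?_⟩
    · simp [epsC, hij.ne]
    · simp [epsC, hij.ne']
    · intro k hi hj
      simp [epsC, hi, hj]

lemma card_sdiff_le_one_of_long (hapos : ∀ i, 0 < a i) {s : Fin m}
    (h : SC a b (2 • epsC m s)) : (Finset.univ.image a \ Finset.univ.image b).card ≤ 1 := by
  have := h.sdiff_subset_pair hapos (i := s) (j := s) fun k hk _ => two_epsC_apply_of_ne hk
  simpa using Finset.card_le_card this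

lemma card_sdiff_le_two (hapos : ∀ i, 0 < a i) {γ : Fin m → ℤ} (hγ : γ ∈ posRootsC m)
    (h : SC a b γ) : (Finset.univ.image a \ Finset.univ.image b).card ≤ 2 := by
  rcases mem_posRootsC_cases hγ with ⟨s, rfl⟩ | ⟨i, j, -, c, -, -, -, -, h0⟩
  · exact (card_sdiff_le_one_of_long hapos h).trans one_le_two
  · exact (Finset.card_le_card (h.sdiff_subset_pair hapos h0)).trans Finset.card_le_two

lemma subsingleton_of_card_sdiff_eq_two (ha : StrictAnti a) (hapos : ∀ i, 0 < a i)
    (hD : (Finset.univ.image a \ Finset.univ.image b).card = 2) :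
    {γ ∈ posRootsC m | SC a b γ}.Subsingleton := by
  rintro γ ⟨hγ, h⟩ γ' ⟨hγ', h'⟩
  rcases mem_posRootsC_cases hγ with ⟨s, rfl⟩ | ⟨i, j, hij, c, hc, hγe, hi, hj, h0⟩
  · have := card_sdiff_le_one_of_long hapos h
    omega
  rcases mem_posRootsC_cases hγ' with ⟨s, rfl⟩ | ⟨i', j', hij', c', hc', hγe', hi', hj', h0'⟩
  · have := card_sdiff_le_one_of_long hapos h'
    omega
  have hE := Finset.eq_of_subset_of_card_le (h.sdiff_subset_pair hapos h0)
    (Finset.card_le_two.trans hD.ge)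
  have hE' := Finset.eq_of_subset_of_card_le (h'.sdiff_subset_pair hapos h0')
    (Finset.card_le_two.trans hD.ge)
  have hlt := ha hij
  have hlt' := ha hij'
  have hpair : ({a i, a j} : Finset ℤ) = {a i', a j'} := hE.symm.trans hE'
  have hai : a i ∈ ({a i', a j'} : Finset ℤ) := hpair ▸ by simp
  have haj : a j ∈ ({a i', a j'} : Finset ℤ) := hpair ▸ by simp
  simp only [Finset.mem_insert, Finset.mem_singleton] at hai haj
  obtain rfl : i = i' := ha.injective (by omega)
  obtain rfl : j = j' := ha.injective (by omega)
  have hni : a i ∉ Finset.univ.image b :=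
    (Finset.mem_sdiff.1 (hE.symm.subset (by simp : a i ∈ ({a i, a j} : Finset ℤ)))).2
  have hnj : a j ∉ Finset.univ.image b :=
    (Finset.mem_sdiff.1 (hE.symm.subset (by simp : a j ∈ ({a i, a j} : Finset ℤ)))).2
  obtain ⟨n, hn, hn1, hn2⟩ := h.exists_pair hapos hij.ne h0
  obtain ⟨n', hn', -, -⟩ := h'.exists_pair hapos hij.ne h0'
  rw [hi, hj] at hn
  rw [hi] at hn1
  rw [hj] at hn2
  rw [hi', hj'] at hn'
  have hcc := cons_cons_cancel (hn.symm.trans hn')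
  have h1 := ne_of_mem_of_not_mem hn1 hni
  have h2 := ne_of_mem_of_not_mem hn1 hnj
  have h3 := ne_of_mem_of_not_mem hn2 hni
  have h4 := ne_of_mem_of_not_mem hn2 hnj
  have := hapos i
  have := hapos j
  rcases hc with rfl | rfl <;> rcases hc' with rfl | rfl
  · rw [hγe, hγe']
  · exfalso
    simp only [mul_one, mul_neg, abs_eq_max_neg] at *
    omega
  · exfalso
    simp only [mul_one, mul_neg, abs_eq_max_neg] at *
    omega
  · rw [hγe, hγe']

/-- An injective `a` attains a prescribed doubled value at most once. -/
lemma exists_forall_two_mul_eq (ha : Function.Injective a) (s : Fin m) (v : ℤ) :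
    ∃ T, ∀ t, 2 * a t = v → t = T := by
  by_cases h : ∃ t, 2 * a t = v
  · obtain ⟨T, hT⟩ := h
    exact ⟨T, fun t ht => ha (by omega)⟩
  · exact ⟨s, fun t ht => (h ⟨t, ht⟩).elim⟩

lemma ncard_le_three_of_card_sdiff_eq_one (ha : StrictAnti a) (hapos : ∀ i, 0 < a i)
    (hb : StrictAnti b) (hbpos : ∀ i, 0 < b i)
    (hD : (Finset.univ.image a \ Finset.univ.image b).card = 1) :
    {γ ∈ posRootsC m | SC a b γ}.ncard ≤ 3 := by
  have hD' : (Finset.univ.image b \ Finset.univ.image a).card = 1 := by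
    rw [← hD]
    apply Finset.card_sdiff_comm
    rw [Finset.card_image_of_injective _ ha.injective, Finset.card_image_of_injective _ hb.injective]
  obtain ⟨x, hx⟩ := Finset.card_eq_one.1 hD
  obtain ⟨y, hy⟩ := Finset.card_eq_one.1 hD'
  obtain ⟨hxA, hxB⟩ := Finset.mem_sdiff.1 (hx ▸ Finset.mem_singleton_self x)
  obtain ⟨hyB, hyA⟩ := Finset.mem_sdiff.1 (hy ▸ Finset.mem_singleton_self y)
  have hswap : x ::ₘ Finset.univ.val.map b = y ::ₘ Finset.univ.val.map a := by
    rw [map_eq_image_val ha.injective, map_eq_image_val hb.injective,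
      ← Finset.insert_val_of_notMem hxB, ← Finset.insert_val_of_notMem hyA]
    congr 1
    ext z
    have h1 := Finset.ext_iff.1 hx z
    have h2 := Finset.ext_iff.1 hy z
    simp only [Finset.mem_sdiff, Finset.mem_singleton, Finset.mem_insert] at *
    tauto
  have hxy : x ≠ y := ne_of_mem_of_not_mem hxA hyA
  obtain ⟨s, -, rfl⟩ := Finset.mem_image.1 hxA
  obtain ⟨u, -, rfl⟩ := Finset.mem_image.1 hyB
  have hs0 := hapos s
  have hu0 := hbpos u
  obtain ⟨T, hT⟩ := exists_forall_two_mul_eq ha.injective s (a s + b u)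
  obtain ⟨R, hR⟩ := exists_forall_two_mul_eq ha.injective s |a s - b u|
  have hsub : {γ ∈ posRootsC m | SC a b γ} ⊆
      (({2 • epsC m s, epsC m s + epsC m T,
        if b u < a s then epsC m s + epsC m R
        else if s < R then epsC m s - epsC m R else epsC m R - epsC m s} :
          Finset (Fin m → ℤ)) : Set (Fin m → ℤ)) := by
    rintro γ ⟨hγ, h⟩
    simp only [Finset.coe_insert, Finset.coe_singleton, Set.mem_insert_iff, Set.mem_singleton_iff]
    rcases mem_posRootsC_cases hγ with ⟨t, rfl⟩ | ⟨i, j, hij, c, hc, hγe, hi, hj, h0⟩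
    · have := h.sdiff_subset_pair hapos (i := t) (j := t) fun k hk _ => two_epsC_apply_of_ne hk
      rw [hx] at this
      obtain rfl : s = t := ha.injective (by simpa using this)
      exact Or.inl rfl
    have hsij : s = i ∨ s = j := by
      have := h.sdiff_subset_pair hapos h0
      rw [hx] at this
      simpa [ha.injective.eq_iff] using this
    obtain ⟨n, hn, -, -⟩ := h.exists_pair hapos hij.ne h0
    rw [hi, hj] at hn
    have hi0 := hapos i
    have hj0 := hapos j
    rcases hsij with rfl | rfl
    · rw [Multiset.cons_swap, hswap] at hn
      have hpq := cons_cons_cancel hn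
      rcases hc with rfl | rfl
      · have : 2 * a j = a s + b u ∨ (b u < a s ∧ 2 * a j = |a s - b u|) := by
          simp only [mul_one, abs_eq_max_neg] at *
          omega
        rcases this with h2 | ⟨hlt, h2⟩
        · obtain rfl := hT j h2
          simp [hγe]
        · obtain rfl := hR j h2
          simp [hγe, hlt]
      · have : ¬ b u < a s ∧ 2 * a j = |a s - b u| := by
          simp only [mul_one, mul_neg, abs_eq_max_neg] at *
          omega
        obtain rfl := hR j this.2
        simp [hγe, this.1, hij, sub_eq_add_neg]
    · rw [hswap] at hn
      have hpq := cons_cons_cancel hn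
      rcases hc with rfl | rfl
      · have : 2 * a i = a s + b u ∨ (b u < a s ∧ 2 * a i = |a s - b u|) := by
          simp only [mul_one, abs_eq_max_neg] at *
          omega
        rcases this with h2 | ⟨hlt, h2⟩
        · obtain rfl := hT i h2
          simp [hγe, add_comm]
        · obtain rfl := hR i h2
          simp [hγe, hlt, add_comm]
      · have : ¬ b u < a s ∧ 2 * a i = |a s - b u| := by
          simp only [mul_one, mul_neg, abs_eq_max_neg] at *
          omega
        obtain rfl := hR i this.2
        simp [hγe, this.1, hij.not_gt, sub_eq_add_neg]
  refine (Set.ncard_le_ncard hsub (Finset.finite_toSet _)).trans ?_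
  rw [Set.ncard_coe_finset]
  exact Finset.card_le_three

lemma card_sdiff_ne_zero (ha : StrictAnti a) (hb : StrictAnti b) (hab : a ≠ b) :
    (Finset.univ.image a \ Finset.univ.image b).card ≠ 0 := by
  intro h
  rw [Finset.card_eq_zero, Finset.sdiff_eq_empty_iff_subset] at h
  have heq := Finset.eq_of_subset_of_card_le h (by
    rw [Finset.card_image_of_injective _ ha.injective,
      Finset.card_image_of_injective _ hb.injective])
  apply hab
  rw [← StrictAnti.range_inj ha hb]
  simpa using congrArg (fun s : Finset ℤ => (s : Set ℤ)) heq

end TypeC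

theorem statement17 (m : ℕ) (hm : 2 ≤ m) (a b : Fin m → ℤ)
    (ha : StrictAnti a) (hapos : ∀ i, 0 < a i)
    (hb : StrictAnti b) (hbpos : ∀ i, 0 < b i)
    (hab : a ≠ b) :
    ((Finset.image a Finset.univ \ Finset.image b Finset.univ).card = 2 →
      {γ ∈ posRootsC m | SC a b γ}.Subsingleton) ∧
    ((Finset.image a Finset.univ \ Finset.image b Finset.univ).card = 1 →
      {γ ∈ posRootsC m | SC a b γ}.ncard ≤ 3) ∧
    (3 ≤ (Finset.image a Finset.univ \ Finset.image b Finset.univ).card →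
      {γ ∈ posRootsC m | SC a b γ} = ∅) ∧
    {γ ∈ posRootsC m | SC a b γ}.ncard ≤ 3 := by
  have htwo := subsingleton_of_card_sdiff_eq_two (b := b) ha hapos
  have hone := ncard_le_three_of_card_sdiff_eq_one ha hapos hb hbpos
  refine ⟨htwo, hone, fun h => ?_, ?_⟩
  · refine Set.eq_empty_of_forall_notMem fun γ hγ => ?_
    have := card_sdiff_le_two hapos hγ.1 hγ.2
    omega
  · rcases Set.eq_empty_or_nonempty {γ ∈ posRootsC m | SC a b γ} with he | ⟨γ, hγ⟩
    · simp [he]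
    · have hle := card_sdiff_le_two hapos hγ.1 hγ.2
      have hne := card_sdiff_ne_zero ha hb hab
      rcases (by omega : (Finset.image a Finset.univ \ Finset.image b Finset.univ).card = 1 ∨
        (Finset.image a Finset.univ \ Finset.image b Finset.univ).card = 2) with h | h
      · exact hone h
      · exact ((Set.ncard_le_one (htwo h).finite).2 fun _ h₁ _ h₂ => htwo h h₁ h₂).trans (by norm_num)
end

section
/- (Type D, two-element difference sets.) In the type D setting, if |D'_ab| = 2 then S(a,b) contains at most one element. -/
/-- the standard basis vector `ε_s` of `ℚ^m`. -/
def epsD (m : ℕ) (s : Fin m) : Fin m → ℚ := Pi.single s 1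

/-- The positive roots of `D_m`: the `ε_i ± ε_j`, `i < j`. -/
def posRootsD (m : ℕ) : Set (Fin m → ℚ) :=
  {γ | ∃ i j : Fin m, i < j ∧ (γ = epsD m i - epsD m j ∨ γ = epsD m i + epsD m j)}

/-- `γ ∈ S(a,b)`: for some `n ∈ ℤ` the multiset `{|a_1 − nγ_1|, …, |a_m − nγ_m|}`
equals the multiset `{|b_1|, …, |b_m|}` and the sign products agree
(with the convention `sign 0 = 0`). -/
def SD {m : ℕ} (a b : Fin m → ℚ) (γ : Fin m → ℚ) : Prop :=
  ∃ n : ℤ,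
    ((Finset.univ.val.map fun i => |a i - (n : ℚ) * γ i|) =
      Finset.univ.val.map fun i => |b i|) ∧
    (∏ i, SignType.sign (a i - (n : ℚ) * γ i)) = ∏ i, SignType.sign (b i)

/-- The type `D` setting: `a_1 > ⋯ > a_{m−1} > |a_m|` and `b_1 > ⋯ > b_{m−1} > |b_m|`,
the `2a_i`, `2b_i`, `a_i − a_j`, `b_i − b_j` and `a_i − b_j` are all integers. -/
structure TypeDData (m : ℕ) (a b : Fin m → ℚ) : Prop where
  ha : ∀ i j : Fin m, i < j → |a j| < a i
  hb : ∀ i j : Fin m, i < j → |b j| < b i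
  haint : ∀ i, ∃ k : ℤ, 2 * a i = k
  haint2 : ∀ i j, ∃ k : ℤ, a i - a j = k
  hbint : ∀ i, ∃ k : ℤ, 2 * b i = k
  hbint2 : ∀ i j, ∃ k : ℤ, b i - b j = k
  habint : ∀ i j, ∃ k : ℤ, a i - b j = k

open Finset in
/-- If the multiset of the `|f l|` is that of the `|b l|`, `f` agrees with `a` off `{i, j}`, and
exactly two of the `|a l|` are not among the `|b l|`, then these two are `|a i|` and `|a j|`. -/
theorem sdiff_image_abs_eq_pair {m : ℕ} {a b f : Fin m → ℚ} {i j : Fin m}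
    (hf : ∀ l, l ≠ i → l ≠ j → f l = a l)
    (hfb : (univ.val.map fun l => |f l|) = univ.val.map fun l => |b l|)
    (hD : ((univ.image fun l => |a l|) \ (univ.image fun l => |b l|)).card = 2) :
    (univ.image fun l => |a l|) \ (univ.image fun l => |b l|) = {|a i|, |a j|} := by
  refine eq_of_subset_of_card_le (fun x hx => ?_) (hD ▸ card_le_two)
  simp only [mem_sdiff, mem_image, mem_univ, true_and] at hx
  obtain ⟨⟨l, rfl⟩, hl⟩ := hx
  by_contra hne
  simp only [mem_insert, mem_singleton, not_or] at hne
  have hmem : |f l| ∈ univ.val.map fun l => |b l| :=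
    hfb ▸ Multiset.mem_map_of_mem _ (mem_univ_val l)
  rw [hf l (fun e => hne.1 (e ▸ rfl)) (fun e => hne.2 (e ▸ rfl))] at hmem
  obtain ⟨k, -, hk⟩ := Multiset.mem_map.1 hmem
  exact hl ⟨k, hk⟩

/-- Two families with the same absolute values which agree off `{i, j}` have the same
even power sums on `{i, j}`. -/
theorem pow_add_pow_eq_of_map_abs_eq {m : ℕ} {f g : Fin m → ℚ} {i j : Fin m} (hij : i ≠ j)
    (hfg : ∀ l, l ≠ i → l ≠ j → f l = g l)
    (habs : (Finset.univ.val.map fun l => |f l|) = Finset.univ.val.map fun l => |g l|)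
    {p : ℕ} (hp : Even p) : f i ^ p + f j ^ p = g i ^ p + g j ^ p := by
  have hsum : ∑ l, f l ^ p = ∑ l, g l ^ p := by
    have := congrArg (fun s : Multiset ℚ => (s.map (· ^ p)).sum) habs
    simpa only [Multiset.map_map, Function.comp_def, hp.pow_abs, Finset.sum] using this
  have hdiff : ∑ l, (f l ^ p - g l ^ p) = (f i ^ p - g i ^ p) + (f j ^ p - g j ^ p) :=
    Finset.sum_eq_add i j hij (fun l _ hl => by rw [hfg l hl.1 hl.2, sub_self])
      (by simp) (by simp)
  rw [Finset.sum_sub_distrib, hsum, sub_self] at hdiff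
  linarith

/-- If `f` and `g` agree off `{i, j}`, have no zero there, and have the same product of signs,
then the products of their entries at `i` and `j` have the same sign. -/
theorem sign_mul_eq_of_prod_sign_eq {m : ℕ} {f g : Fin m → ℚ} {i j : Fin m} (hij : i ≠ j)
    (hfg : ∀ l, l ≠ i → l ≠ j → f l = g l) (hne : ∀ l, l ≠ i → l ≠ j → g l ≠ 0)
    (hsign : ∏ l, SignType.sign (f l) = ∏ l, SignType.sign (g l)) :
    SignType.sign (f i * f j) = SignType.sign (g i * g j) := by
  have hsplit (φ : Fin m → ℚ) : ∏ l, SignType.sign (φ l) =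
      SignType.sign (φ i * φ j) * ∏ l ∈ (Finset.univ.erase i).erase j, SignType.sign (φ l) := by
    rw [← Finset.mul_prod_erase _ _ (Finset.mem_univ i),
      ← Finset.mul_prod_erase _ _ (Finset.mem_erase.2 ⟨hij.symm, Finset.mem_univ j⟩),
      sign_mul, mul_assoc]
  have hrest : ∏ l ∈ (Finset.univ.erase i).erase j, SignType.sign (f l) =
      ∏ l ∈ (Finset.univ.erase i).erase j, SignType.sign (g l) :=
    Finset.prod_congr rfl fun l hl => by
      simp only [Finset.mem_erase] at hl
      rw [hfg l hl.2.1 hl.1]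
  have hrest_ne : ∏ l ∈ (Finset.univ.erase i).erase j, SignType.sign (g l) ≠ 0 :=
    Finset.prod_ne_zero_iff.2 fun l hl => by
      simp only [Finset.mem_erase] at hl
      exact sign_ne_zero.2 (hne l hl.2.1 hl.1)
  rw [hsplit f, hsplit g, hrest] at hsign
  exact mul_right_cancel₀ hrest_ne hsign

/-- A modification of `a` along `ε_i - ε_j` and one along `ε_i + ε_j` which have the same
absolute values and the same product of signs only permute `a i` and `a j`. -/
theorem eq_or_eq_of_add_eq_of_sub_eq {m : ℕ} {a f g : Fin m → ℚ} {i j : Fin m} (hij : i ≠ j)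
    (ha : Function.Injective fun l => |a l|)
    (hf : ∀ l, l ≠ i → l ≠ j → f l = a l) (hg : ∀ l, l ≠ i → l ≠ j → g l = a l)
    (hadd : f i + f j = a i + a j) (hsub : g i - g j = a i - a j)
    (habs : (Finset.univ.val.map fun l => |f l|) = Finset.univ.val.map fun l => |g l|)
    (hsign : ∏ l, SignType.sign (f l) = ∏ l, SignType.sign (g l)) :
    f i = a i ∨ f i = a j := by
  have hfg (l : Fin m) (hi : l ≠ i) (hj : l ≠ j) : f l = g l := (hf l hi hj).trans (hg l hi hj).symm
  have h2 := pow_add_pow_eq_of_map_abs_eq hij hfg habs even_two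
  have h4 := pow_add_pow_eq_of_map_abs_eq hij hfg habs (p := 4) (by decide)
  have hmul : f i * f j = g i * g j ∨ f i * f j = -(g i * g j) := by
    rw [← sq_eq_sq_iff_eq_or_eq_neg]
    linear_combination (f i ^ 2 + f j ^ 2 + g i ^ 2 + g j ^ 2) / 2 * h2 - h4 / 2
  have hprod : f i * f j = g i * g j := by
    by_cases hne : ∀ l, l ≠ i → l ≠ j → a l ≠ 0
    · have hs := sign_mul_eq_of_prod_sign_eq hij hfg
        (fun l hi hj => hg l hi hj ▸ hne l hi hj) hsign
      have habs_mul : |f i * f j| = |g i * g j| := abs_eq_abs.2 hmul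
      rw [← sign_mul_abs (f i * f j), hs, habs_mul, sign_mul_abs]
    · push Not at hne
      obtain ⟨k, hki, hkj, hk⟩ := hne
      refine hmul.resolve_right fun hneg => ?_
      have hzero : a i * a j = 0 := by
        linear_combination h2 / 4 + hneg / 2 - (f i + f j + a i + a j) / 4 * hadd
          + (g i - g j + a i - a j) / 4 * hsub
      rcases mul_eq_zero.1 hzero with h0 | h0
      · exact hki (ha (by simp [hk, h0]))
      · exact hkj (ha (by simp [hk, h0]))
  have hfac : (f i - a i) * (f i - a j) = 0 := by
    linear_combination f i * hadd + h2 / 4 - hprod / 2 - (f i + f j + a i + a j) / 4 * hadd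
      + (g i - g j + a i - a j) / 4 * hsub
  simpa [sub_eq_zero] using hfac

/-- The coordinates of a positive root: it is `1` at `i`, `±1` at `j > i`, and `0` elsewhere. -/
theorem exists_of_mem_posRootsD {m : ℕ} {γ : Fin m → ℚ} (hγ : γ ∈ posRootsD m) :
    ∃ i j : Fin m, i < j ∧ (∀ l, l ≠ i → l ≠ j → γ l = 0) ∧ γ i = 1 ∧
      (γ = epsD m i - epsD m j ∧ γ j = -1 ∨ γ = epsD m i + epsD m j ∧ γ j = 1) := by
  obtain ⟨i, j, hij, h⟩ := hγ
  refine ⟨i, j, hij, ?_⟩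
  rcases h with rfl | rfl <;>
    simp +contextual [epsD, hij.ne, hij.ne']

theorem statement18 (m : ℕ) (hm : 2 ≤ m) (a b : Fin m → ℚ) (h : TypeDData m a b)
    (hD : ((Finset.univ.image fun i => |a i|) \ (Finset.univ.image fun i => |b i|)).card = 2) :
    {γ ∈ posRootsD m | SD a b γ}.Subsingleton := by
  have hinj : Function.Injective fun l => |a l| :=
    Function.Injective.of_lt_imp_ne fun l k hlk =>
      ((h.ha l k hlk).trans_le (le_abs_self _)).ne'
  rintro γ ⟨hγ, n, hn, hns⟩ δ ⟨hδ, k, hk, hks⟩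
  obtain ⟨i, j, hij, hγ0, hγi, hγ⟩ := exists_of_mem_posRootsD hγ
  obtain ⟨i', j', hij', hδ0, hδi, hδ⟩ := exists_of_mem_posRootsD hδ
  have hf : ∀ l, l ≠ i → l ≠ j → a l - n * γ l = a l := fun l hi hj => by simp [hγ0 l hi hj]
  have hg : ∀ l, l ≠ i' → l ≠ j' → a l - k * δ l = a l := fun l hi hj => by simp [hδ0 l hi hj]
  have hpair := sdiff_image_abs_eq_pair hf hn hD
  have hpair' := sdiff_image_abs_eq_pair hg hk hD
  obtain ⟨rfl, rfl⟩ : i = i' ∧ j = j' := by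
    have hmem (x : ℚ) : (x = |a i| ∨ x = |a j|) ↔ (x = |a i'| ∨ x = |a j'|) := by
      simpa using Finset.ext_iff.1 (hpair.symm.trans hpair') x
    have hi := (hmem |a i|).1 (Or.inl rfl)
    have hj := (hmem |a j|).1 (Or.inr rfl)
    rw [hinj.eq_iff, hinj.eq_iff] at hi hj
    omega
  have hnotMem {f : Fin m → ℚ}
      (hfb : (Finset.univ.val.map fun l => |f l|) = Finset.univ.val.map fun l => |b l|) :
      ¬ (f i = a i ∨ f i = a j) := by
    intro hfi
    have hmem : |f i| ∈ Finset.univ.image fun l => |b l| := by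
      rw [Finset.mem_image]
      simpa using (hfb ▸ Multiset.mem_map_of_mem _ (Finset.mem_univ_val i) :
        |f i| ∈ Finset.univ.val.map fun l => |b l|)
    have hmem' : |f i| ∈ ({|a i|, |a j|} : Finset ℚ) := by
      rcases hfi with e | e <;> simp [e]
    rw [← hpair] at hmem'
    exact (Finset.mem_sdiff.1 hmem').2 hmem
  rcases hγ with ⟨rfl, hγj⟩ | ⟨rfl, hγj⟩ <;> rcases hδ with ⟨rfl, hδj⟩ | ⟨rfl, hδj⟩
  · rfl
  · exact (hnotMem hn (eq_or_eq_of_add_eq_of_sub_eq hij.ne hinj hf hg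
      (by rw [hγi, hγj]; ring) (by rw [hδi, hδj]; ring) (hn.trans hk.symm)
      (hns.trans hks.symm))).elim
  · exact (hnotMem hk (eq_or_eq_of_add_eq_of_sub_eq hij.ne hinj hg hf
      (by rw [hδi, hδj]; ring) (by rw [hγi, hγj]; ring) (hk.trans hn.symm)
      (hks.trans hns.symm))).elim
  · rfl
end

section
/- (Type D, singleton difference sets.) In the type D setting, if |D'_ab| = 1 then S(a,b) contains at most two elements; moreover, if |S(a,b)| = 2 then a_m = 0 and b_m = 0. -/
/-- The positive root of `D_m` supported on `{k, l}` in which the coordinate of larger index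
has value `σ`. -/
def rootD {m : ℕ} (k l : Fin m) (σ : ℚ) : Fin m → ℚ :=
  if k < l then epsD m k + σ • epsD m l else epsD m l + σ • epsD m k

/-- The root `γ` is supported on `k` and some `l` with `2 a_l = ±(a_k + z)`, the sign being the
relative sign of the two coordinates of `γ`. -/
def IsHalfSumRoot {m : ℕ} (a : Fin m → ℚ) (k : Fin m) (z : ℚ) (γ : Fin m → ℚ) : Prop :=
  ∃ (l : Fin m) (σ : ℚ), (σ = 1 ∨ σ = -1) ∧ γ = rootD k l σ ∧ 2 * a l = σ * (a k + z)

theorem IsHalfSumRoot.unique {m : ℕ} {a : Fin m → ℚ} (hinj : Function.Injective fun i => |a i|)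
    {k : Fin m} {z : ℚ} (hz : a k + z ≠ 0) {γ γ' : Fin m → ℚ}
    (h : IsHalfSumRoot a k z γ) (h' : IsHalfSumRoot a k z γ') : γ = γ' := by
  obtain ⟨l, σ, hσ, rfl, hl⟩ := h
  obtain ⟨l', σ', hσ', rfl, hl'⟩ := h'
  have hll : l = l' := by
    apply hinj
    change |a l| = |a l'|
    rw [abs_eq_abs]
    rcases hσ with rfl | rfl <;> rcases hσ' with rfl | rfl
    · left; linarith
    · right; linarith
    · right; linarith
    · left; linarith
  subst hll
  rw [mul_right_cancel₀ hz (hl.symm.trans hl')]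

theorem injective_abs_of_dominant {m : ℕ} {a : Fin m → ℚ}
    (ha : ∀ i j : Fin m, i < j → |a j| < a i) : Function.Injective fun i => |a i| := by
  intro i j hij
  change |a i| = |a j| at hij
  rcases lt_trichotomy i j with h | h | h
  · linarith [ha i j h, le_abs_self (a i)]
  · exact h
  · linarith [ha j i h, le_abs_self (a j)]

theorem last_eq_zero_of_dominant {m : ℕ} (hm : m - 1 < m) {a : Fin m → ℚ}
    (ha : ∀ i j : Fin m, i < j → |a j| < a i) {i : Fin m} (hi : a i = 0) : a ⟨m - 1, hm⟩ = 0 := by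
  rcases (Fin.le_def.2 (by simp; omega) : i ≤ ⟨m - 1, hm⟩).lt_or_eq with h | h
  · linarith [ha _ _ h, abs_nonneg (a ⟨m - 1, hm⟩)]
  · rwa [← h]

/-- If replacing `x, c` by `x - t, c - σ t` replaces the absolute values `|x|, |c|` by `y, |c|`,
then `2 c = σ (x ± y)`. -/
theorem half_sum_of_exchange {x c t σ y x' c' : ℚ} (hσ : σ = 1 ∨ σ = -1)
    (hx' : x' = x - t) (hc' : c' = c - σ * t) (hxy : |x| ≠ y)
    (h : (|x'| = y ∧ |c'| = |c|) ∨ (|c'| = y ∧ |x'| = |c|)) :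
    ∃ η : ℚ, (η = 1 ∨ η = -1) ∧ 2 * c = σ * (x + η * y) ∧ x' * c' = η * y * c := by
  have hy : |y| = y := by rcases h with h | h <;> rw [← h.1, abs_abs]
  have hxy1 : x ≠ y := fun e => hxy (by rw [e, hy])
  have hxy2 : x ≠ -y := fun e => hxy (by rw [e, abs_neg, hy])
  subst hx' hc'
  have hss : σ * σ = 1 := by rcases hσ with rfl | rfl <;> norm_num
  rcases h with ⟨h1, h2⟩ | ⟨h1, h2⟩
  · rw [← hy, abs_eq_abs] at h1
    rw [abs_eq_abs] at h2
    rcases h2 with h2 | h2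
    · have ht : t = 0 := by
        have : σ * (σ * t) = 0 := by rw [show σ * t = 0 by linarith]; ring
        rwa [← mul_assoc, hss, one_mul] at this
      rcases h1 with h1 | h1
      · exact absurd (by linarith) hxy1
      · exact absurd (by linarith) hxy2
    · rcases h1 with h1 | h1
      · refine ⟨-1, .inr rfl, ?_, ?_⟩
        · rw [show t = x - y by linarith] at h2; linarith
        · rw [h1, h2]; ring
      · refine ⟨1, .inl rfl, ?_, ?_⟩
        · rw [show t = x + y by linarith] at h2; linarith
        · rw [h1, h2]; ring
  · rw [← hy, abs_eq_abs] at h1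
    rw [abs_eq_abs] at h2
    rcases hσ with rfl | rfl <;> rcases h1 with h1 | h1 <;> rcases h2 with h2 | h2
    · exact ⟨1, .inl rfl, by linarith, by rw [h1, h2]; ring⟩
    · exact absurd (by linarith) hxy2
    · exact ⟨-1, .inr rfl, by linarith, by rw [h1, h2]; ring⟩
    · exact absurd (by linarith) hxy1
    · exact absurd (by linarith) hxy1
    · exact ⟨-1, .inr rfl, by linarith, by rw [h1, h2]; ring⟩
    · exact absurd (by linarith) hxy2
    · exact ⟨1, .inl rfl, by linarith, by rw [h1, h2]; ring⟩

theorem exists_rootD_of_mem_posRootsD {m : ℕ} {γ : Fin m → ℚ} (hγ : γ ∈ posRootsD m)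
    {k : Fin m} (hk : γ k ≠ 0) :
    ∃ (l : Fin m) (σ : ℚ), l ≠ k ∧ (σ = 1 ∨ σ = -1) ∧ γ = rootD k l σ ∧
      γ l = σ * γ k ∧ ∀ i, i ≠ k → i ≠ l → γ i = 0 := by
  obtain ⟨i, j, hij, hγ⟩ := hγ
  obtain ⟨σ, hσ, rfl⟩ : ∃ σ : ℚ, (σ = 1 ∨ σ = -1) ∧ γ = epsD m i + σ • epsD m j := by
    rcases hγ with rfl | rfl
    · exact ⟨-1, .inr rfl, by simp [sub_eq_add_neg]⟩
    · exact ⟨1, .inl rfl, by simp⟩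
  have hss : σ * σ = 1 := by rcases hσ with rfl | rfl <;> norm_num
  have hkij : k = i ∨ k = j := by
    by_contra! hne
    simp [epsD, hne.1, hne.2] at hk
  rcases hkij with rfl | rfl
  · exact ⟨j, σ, hij.ne', hσ, by simp [rootD, hij], by simp [epsD, hij.ne, hij.ne'],
      fun p h1 h2 => by simp [epsD, h1, h2]⟩
  · exact ⟨i, σ, hij.ne, hσ, by simp [rootD, hij.not_gt], by simp [epsD, hij.ne, hij.ne', hss],
      fun p h1 h2 => by simp [epsD, h1, h2]⟩

theorem isHalfSumRoot_of_SD {m : ℕ} {a b : Fin m → ℚ}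
    (hinj : Function.Injective fun i => |a i|) {k : Fin m} {y : ℚ}
    (hk : ∀ i, |b i| ≠ |a k|) (hk' : ∀ i, i ≠ k → ∃ j, |b j| = |a i|)
    (hy : ∃ j, |b j| = y) (hy' : ∀ i, |a i| ≠ y)
    {γ : Fin m → ℚ} (hγ : γ ∈ posRootsD m) (hS : SD a b γ) :
    ∃ η : ℚ, (η = 1 ∨ η = -1) ∧ IsHalfSumRoot a k (η * y) γ ∧
      SignType.sign (η * y) * ∏ i ∈ Finset.univ.erase k, SignType.sign (a i) =
        ∏ i, SignType.sign (b i) := by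
  obtain ⟨n, hn, hs⟩ := hS
  have hmem : ∀ z : ℚ, (∃ i, |a i - n * γ i| = z) ↔ ∃ i, |b i| = z := fun z => by
    simpa using congrArg (z ∈ ·) hn
  have hγk : γ k ≠ 0 := by
    intro h0
    obtain ⟨i, hi⟩ := (hmem |a k|).1 ⟨k, by simp [h0]⟩
    exact hk i hi
  obtain ⟨l, σ, hlk, hσ, hγr, hγl, hγ0⟩ := exists_rootD_of_mem_posRootsD hγ hγk
  obtain ⟨p, hp⟩ := (hmem y).2 hy
  obtain ⟨q, hq⟩ := (hmem |a l|).2 (hk' l hlk)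
  have hp' : p = k ∨ p = l := by
    by_contra! hne
    rw [hγ0 p hne.1 hne.2, mul_zero, sub_zero] at hp
    exact hy' p hp
  have hq' : q = k ∨ q = l := by
    by_contra! hne
    rw [hγ0 q hne.1 hne.2, mul_zero, sub_zero] at hq
    exact hne.2 (hinj hq)
  have hpq : p ≠ q := by
    rintro rfl
    exact hy' l (hq.symm.trans hp)
  obtain ⟨η, hη, h2, hprod⟩ := half_sum_of_exchange (x := a k) (c := a l) (t := n * γ k) (y := y)
    hσ rfl (show a l - n * γ l = _ by rw [hγl]; ring) (hy' k) (by
      rcases hp' with rfl | rfl <;> rcases hq' with rfl | rfl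
      · exact absurd rfl hpq
      · exact .inl ⟨hp, hq⟩
      · exact .inr ⟨hp, hq⟩
      · exact absurd rfl hpq)
  refine ⟨η, hη, ⟨l, σ, hσ, hγr, h2⟩, ?_⟩
  have hl : l ∈ Finset.univ.erase k := by simp [hlk]
  rw [← hs, ← Finset.mul_prod_erase _ _ (Finset.mem_univ k), ← Finset.mul_prod_erase _ _ hl,
    ← Finset.mul_prod_erase _ _ hl, ← mul_assoc, ← mul_assoc, ← sign_mul, ← sign_mul, hprod]
  congr 1
  refine Finset.prod_congr rfl fun i hi => ?_
  simp only [Finset.mem_erase] at hi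
  rw [hγ0 i hi.2.1 hi.1, mul_zero, sub_zero]

theorem statement19 (m : ℕ) (hm : 2 ≤ m) (a b : Fin m → ℚ) (h : TypeDData m a b)
    (hD : ((Finset.univ.image fun i => |a i|) \ (Finset.univ.image fun i => |b i|)).card = 1) :
    {γ ∈ posRootsD m | SD a b γ}.ncard ≤ 2 ∧
    ({γ ∈ posRootsD m | SD a b γ}.ncard = 2 →
      a ⟨m - 1, by omega⟩ = 0 ∧ b ⟨m - 1, by omega⟩ = 0) := by
  have hinj := injective_abs_of_dominant h.ha
  have hinjb := injective_abs_of_dominant h.hb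
  have hD' := hD
  rw [Finset.card_sdiff_comm (by
    rw [Finset.card_image_of_injective _ hinj, Finset.card_image_of_injective _ hinjb])] at hD'
  obtain ⟨x, hx⟩ := Finset.card_eq_one.1 hD
  obtain ⟨y, hy⟩ := Finset.card_eq_one.1 hD'
  have hx1 : ∀ z, ((∃ i, |a i| = z) ∧ ∀ i, |b i| ≠ z) ↔ z = x := fun z => by
    simpa using congrArg (z ∈ ·) hx
  have hy1 : ∀ z, ((∃ i, |b i| = z) ∧ ∀ i, |a i| ≠ z) ↔ z = y := fun z => by
    simpa using congrArg (z ∈ ·) hy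
  obtain ⟨⟨k, rfl⟩, hk⟩ := (hx1 x).2 rfl
  obtain ⟨hyb, hya⟩ := (hy1 y).2 rfl
  have hk' : ∀ i, i ≠ k → ∃ j, |b j| = |a i| := by
    intro i hi
    by_contra! hne
    exact hi (hinj ((hx1 _).1 ⟨⟨i, rfl⟩, hne⟩))
  have hy0 : |y| = y := by
    obtain ⟨j, rfl⟩ := hyb
    exact abs_abs _
  have hz : ∀ η : ℚ, (η = 1 ∨ η = -1) → a k + η * y ≠ 0 := by
    intro η hη h0
    apply hya k
    rw [← hy0, abs_eq_abs]
    rcases hη with rfl | rfl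
    · right; linarith
    · left; linarith
  have key : ∀ γ ∈ {γ ∈ posRootsD m | SD a b γ}, _ := fun γ hγ =>
    isHalfSumRoot_of_SD hinj hk hk' hyb hya hγ.1 hγ.2
  refine ⟨?_, fun h2 => ?_⟩
  · have hsub : ∀ η : ℚ, (η = 1 ∨ η = -1) → {γ | IsHalfSumRoot a k (η * y) γ}.Subsingleton :=
      fun η hη γ hγ γ' hγ' => hγ.unique hinj (hz η hη) hγ'
    have h1 := hsub 1 (.inl rfl)
    have h2 := hsub (-1) (.inr rfl)
    refine (Set.ncard_le_ncard (t := {γ | IsHalfSumRoot a k (1 * y) γ} ∪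
      {γ | IsHalfSumRoot a k (-1 * y) γ}) ?_ (h1.finite.union h2.finite)).trans
      ((Set.ncard_union_le _ _).trans (Nat.add_le_add
        ((Set.ncard_le_one h1.finite).2 fun _ hu _ hv => h1 hu hv)
        ((Set.ncard_le_one h2.finite).2 fun _ hu _ hv => h2 hu hv)))
    intro γ hγ
    obtain ⟨η, rfl | rfl, hη, -⟩ := key γ hγ
    · exact .inl hη
    · exact .inr hη
  · obtain ⟨γ, γ', hne, hS⟩ := Set.ncard_eq_two.1 h2
    obtain ⟨η, hη, hT, hs⟩ := key γ (hS ▸ by simp)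
    obtain ⟨η', hη', hT', hs'⟩ := key γ' (hS ▸ by simp)
    have hηy : η * y ≠ η' * y := fun e => hne (hT.unique hinj (hz η hη) (e ▸ hT'))
    have hyne : y ≠ 0 := fun e => hηy (by simp [e])
    have hneg : η' * y = -(η * y) := by
      rcases hη with rfl | rfl <;> rcases hη' with rfl | rfl <;> first | exact absurd rfl hηy | ring
    have hP : ∏ i, SignType.sign (b i) = 0 := by
      rw [hneg, Left.sign_neg, neg_mul, hs] at hs'
      exact SignType.self_eq_neg_iff.1 hs'.symm
    have hPa : ∏ i ∈ Finset.univ.erase k, SignType.sign (a i) = 0 := by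
      rw [hP, mul_eq_zero, sign_eq_zero_iff] at hs
      refine hs.resolve_left (mul_ne_zero ?_ hyne)
      rcases hη with rfl | rfl <;> norm_num
    obtain ⟨i, -, hi⟩ := Finset.prod_eq_zero_iff.1 hP
    obtain ⟨j, -, hj⟩ := Finset.prod_eq_zero_iff.1 hPa
    exact ⟨last_eq_zero_of_dominant _ h.ha (sign_eq_zero_iff.1 hj),
      last_eq_zero_of_dominant _ h.hb (sign_eq_zero_iff.1 hi)⟩
end
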